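/- Let E ⊂ ℝ be a Borel set, let μ ∈ R(E), and let θ ∈ L^∞(E) be a bounded measurable function on E. Then the singular part μ_s of μ is supported by the set {x ∈ ℝ : sup_{0<y≤1} |∫_{y<|t−x|≤1} θ(t) χ_E(t)/(t−x) dt| < ∞}. -/

import Mathlib

open MeasureTheory Filter Topology

/-- The Herglotz function associated with a positive Borel measure `μ` on `ℝ`
(satisfying `∫ dμ(t)/(t²+1) < ∞`) and constants `a ∈ ℝ`, `b ≥ 0`:
`F(z) = a + b z + ∫ (1/(t - z) - t/(t² + 1)) dμ(t)`. -/
noncomputable def herglotzFn (μ : Measure ℝ) (a b : ℝ) (z : ℂ) : ℂ :=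
  (a : ℂ) + (b : ℂ) * z +
    ∫ t : ℝ, (((t : ℂ) - z)⁻¹ - (t : ℂ) / ((t : ℂ) ^ 2 + 1)) ∂μ

/-- `μ ∈ R(E)`: the measure `μ` satisfies `∫ dμ(t)/(t²+1) < ∞` and for some choice of
`a ∈ ℝ`, `b ≥ 0` the associated Herglotz function `F_μ` is reflectionless on `E`, i.e.
its boundary value has vanishing real part at Lebesgue-a.e. point of `E`. -/
def IsReflectionless (μ : Measure ℝ) (E : Set ℝ) : Prop :=
  Integrable (fun t : ℝ => (t ^ 2 + 1)⁻¹) μ ∧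
  ∃ a b : ℝ, 0 ≤ b ∧
    ∀ᵐ t : ℝ ∂(volume.restrict E),
      Tendsto (fun y : ℝ => (herglotzFn μ a b ((t : ℂ) + y * Complex.I)).re)
        (𝓝[>] (0 : ℝ)) (𝓝 0)

/-- The Poisson kernel of the upper half plane, up to the factor `π`. -/
noncomputable def halfPlanePoisson (x y t : ℝ) : ℝ := y / ((t - x) ^ 2 + y ^ 2)

/-- The Möbius map from the unit disc onto the upper half plane sending `1` to infinity. -/
noncomputable def invCayley (w : ℂ) : ℂ := Complex.I * (1 + w) / (1 - w)

lemma halfPlanePoisson_pos {y : ℝ} (hy : 0 < y) (x t : ℝ) : 0 < halfPlanePoisson x y t := by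
  unfold halfPlanePoisson; positivity

lemma continuous_halfPlanePoisson (x : ℝ) {y : ℝ} (hy : 0 < y) :
    Continuous (halfPlanePoisson x y) := by
  unfold halfPlanePoisson
  exact Continuous.div (by fun_prop) (by fun_prop) (fun t => by positivity)

lemma one_sub_ne_zero_of_mem_ball {w : ℂ} (hw : w ∈ Metric.ball (0 : ℂ) 1) : 1 - w ≠ 0 := by
  intro h
  rw [sub_eq_zero] at h
  simp [← h] at hw

lemma invCayley_im (w : ℂ) :
    (invCayley w).im = (1 - Complex.normSq w) / Complex.normSq (1 - w) := by
  unfold invCayley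
  rw [Complex.div_im]
  simp [Complex.normSq_apply]
  ring

lemma invCayley_im_pos {w : ℂ} (hw : w ∈ Metric.ball (0 : ℂ) 1) : 0 < (invCayley w).im := by
  rw [invCayley_im]
  have h1 := Complex.normSq_pos.2 (one_sub_ne_zero_of_mem_ball hw)
  have h2 : Complex.normSq w < 1 := by
    rw [Complex.normSq_eq_norm_sq]
    have : ‖w‖ < 1 := by simpa using hw
    nlinarith [norm_nonneg w]
  exact div_pos (by linarith) h1

lemma differentiableAt_invCayley {w : ℂ} (hw : 1 - w ≠ 0) : DifferentiableAt ℂ invCayley w := by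
  unfold invCayley
  fun_prop (disch := exact hw)

lemma circleMap_pi_add_two_mul_arctan (s : ℝ) :
    circleMap 0 1 (Real.pi + 2 * Real.arctan s) = ((s : ℂ) - Complex.I) / (s + Complex.I) := by
  have hs : (s : ℂ) + Complex.I ≠ 0 := by
    intro h
    have := congrArg Complex.im h
    simp at this
  have h1 : Complex.exp (Real.arctan s * Complex.I)
      = (1 + s * Complex.I) / (Real.sqrt (1 + s ^ 2) : ℝ) := by
    rw [Complex.exp_mul_I, ← Complex.ofReal_cos, ← Complex.ofReal_sin, Real.cos_arctan,
      Real.sin_arctan]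
    push_cast
    ring
  have h2 : ((Real.sqrt (1 + s ^ 2) : ℝ) : ℂ) ^ 2 = 1 + s ^ 2 := by
    rw [← Complex.ofReal_pow, Real.sq_sqrt (by positivity)]; push_cast; rfl
  have h3 : (1 : ℂ) + s ^ 2 ≠ 0 := by
    have : (0 : ℝ) < 1 + s ^ 2 := by positivity
    exact_mod_cast this.ne'
  have h4 : circleMap 0 1 (Real.pi + 2 * Real.arctan s)
      = - (Complex.exp (Real.arctan s * Complex.I)) ^ 2 := by
    simp only [circleMap, zero_add, Complex.ofReal_one, one_mul]
    push_cast
    rw [← Complex.exp_nat_mul, add_mul, Complex.exp_add, Complex.exp_pi_mul_I]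
    push_cast
    ring_nf
  rw [h4, h1, div_pow, h2, ← neg_div, div_eq_div_iff h3 hs]
  linear_combination (-2 * s - s ^ 2 * Complex.I - s ^ 3) * Complex.I_sq

lemma invCayley_circleMap_arctan (s : ℝ) :
    invCayley (circleMap 0 1 (Real.pi + 2 * Real.arctan s)) = s := by
  have hs : (s : ℂ) + Complex.I ≠ 0 := by
    intro h
    have := congrArg Complex.im h
    simp at this
  rw [circleMap_pi_add_two_mul_arctan, invCayley]
  have h : 1 - ((s : ℂ) - Complex.I) / (s + Complex.I) = 2 * Complex.I / (s + Complex.I) := by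
    field_simp; ring
  rw [h]
  field_simp
  ring

lemma one_sub_circleMap_arctan_ne_zero (s : ℝ) :
    1 - circleMap 0 1 (Real.pi + 2 * Real.arctan s) ≠ 0 := by
  have hs : (s : ℂ) + Complex.I ≠ 0 := by
    intro h
    have := congrArg Complex.im h
    simp at this
  rw [circleMap_pi_add_two_mul_arctan]
  have h : 1 - ((s : ℂ) - Complex.I) / (s + Complex.I) = 2 * Complex.I / (s + Complex.I) := by
    field_simp; ring
  rw [h]
  exact div_ne_zero (by simp) hs

lemma image_pi_add_two_mul_arctan {x y : ℝ} (hy : 0 < y) :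
    Set.image (fun t : ℝ => Real.pi + 2 * Real.arctan ((t - x) / y)) Set.univ
      = Set.Ioo 0 (2 * Real.pi) := by
  ext θ
  simp only [Set.image_univ, Set.mem_range, Set.mem_Ioo]
  constructor
  · rintro ⟨t, rfl⟩
    have h1 := Real.neg_pi_div_two_lt_arctan ((t - x) / y)
    have h2 := Real.arctan_lt_pi_div_two ((t - x) / y)
    constructor <;> linarith
  · rintro ⟨h1, h2⟩
    refine ⟨x + y * Real.tan ((θ - Real.pi) / 2), ?_⟩
    rw [add_sub_cancel_left, mul_div_cancel_left₀ _ hy.ne', Real.arctan_tan] <;> linarith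

lemma lintegral_Ioo_eq_lintegral_halfPlanePoisson (x : ℝ) {y : ℝ} (hy : 0 < y)
    (g : ℝ → ENNReal) :
    ∫⁻ θ in Set.Ioo 0 (2 * Real.pi), g θ
      = 2 * ∫⁻ t, ENNReal.ofReal (halfPlanePoisson x y t)
          * g (Real.pi + 2 * Real.arctan ((t - x) / y)) := by
  rw [← image_pi_add_two_mul_arctan (x := x) hy,
    lintegral_image_eq_lintegral_abs_deriv_mul
      (f' := fun t => 2 * halfPlanePoisson x y t) MeasurableSet.univ]
  · rw [Measure.restrict_univ, ← lintegral_const_mul' _ _ (by simp)]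
    congr 1
    ext t
    rw [abs_of_pos (mul_pos two_pos (halfPlanePoisson_pos hy x t)),
      ENNReal.ofReal_mul (by norm_num), mul_assoc]
    simp
  · intro t _
    have h1 : HasDerivAt (fun t : ℝ => (t - x) / y) (1 / y) t :=
      ((hasDerivAt_id t).sub_const x).div_const y
    have h2 := (h1.arctan.const_mul 2).const_add Real.pi
    refine (h2.congr_deriv ?_).hasDerivWithinAt
    unfold halfPlanePoisson
    field_simp
    ring
  · intro s _ t _ hst
    simp only [add_right_inj, mul_eq_mul_left_iff, OfNat.ofNat_ne_zero, or_false] at hst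
    have := Real.arctan_injective hst
    field_simp at this
    linarith

lemma lintegral_circle_re {φ : ℂ → ℂ} (hφ : DifferentiableOn ℂ φ (Metric.ball 0 1))
    (hpos : ∀ w ∈ Metric.ball (0 : ℂ) 1, 0 ≤ (φ w).re) {r : ℝ} (hr0 : 0 < r) (hr1 : r < 1) :
    ∫⁻ θ in Set.Ioc 0 (2 * Real.pi), ENNReal.ofReal (φ (r * circleMap 0 1 θ)).re
      = ENNReal.ofReal (2 * Real.pi * (φ 0).re) := by
  have hmem : ∀ w ∈ Metric.closedBall (0 : ℂ) 1, (r : ℂ) * w ∈ Metric.ball (0 : ℂ) 1 := by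
    intro w hw
    have h : ‖w‖ ≤ 1 := by simpa using hw
    simp only [Metric.mem_ball, dist_zero_right, norm_mul, Complex.norm_real, Real.norm_eq_abs,
      abs_of_pos hr0]
    nlinarith [norm_nonneg w]
  have hd : DifferentiableOn ℂ (fun w => φ (r * w)) (Metric.closedBall 0 1) :=
    hφ.comp (by fun_prop) hmem
  have hcl : DiffContOnCl ℂ (fun w => φ (r * w)) (Metric.ball 0 |1|) := by
    apply DifferentiableOn.diffContOnCl
    rw [abs_one]
    exact hd.mono Metric.closure_ball_subset_closedBall
  have hci : CircleIntegrable (fun w => φ (r * w)) 0 1 := by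
    apply ContinuousOn.circleIntegrable zero_le_one
    exact hd.continuousOn.mono Metric.sphere_subset_closedBall
  have h1 := hcl.circleAverage
  have h2 := Complex.reCLM.circleAverage_comp_comm hci
  rw [h1, Real.circleAverage_def] at h2
  simp only [Function.comp_apply, Complex.reCLM_apply, smul_eq_mul, mul_zero] at h2
  have h3 : ∫ θ in (0 : ℝ)..2 * Real.pi, (φ (r * circleMap 0 1 θ)).re
      = 2 * Real.pi * (φ 0).re := by
    rw [← h2]; field_simp
  have h4 : IntervalIntegrable (fun θ => (φ (r * circleMap 0 1 θ)).re) volume 0 (2 * Real.pi) := by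
    have := Complex.reCLM.integrable_comp hci.1
    exact (intervalIntegrable_iff_integrableOn_Ioc_of_le (by positivity)).2 this
  rw [← h3, intervalIntegral.integral_of_le (by positivity),
    ofReal_integral_eq_lintegral_ofReal h4.1]
  exact ae_of_all _ fun θ => hpos _ (hmem _ (by simp))

lemma lintegral_halfPlanePoisson_mul_shift_le {f : ℂ → ℂ}
    (hf : DifferentiableOn ℂ f {z | 0 < z.im}) (hpos : ∀ z : ℂ, 0 < z.im → 0 ≤ (f z).re)
    (x : ℝ) {y ε : ℝ} (hy : 0 < y) (hε : 0 < ε) :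
    ∫⁻ t, ENNReal.ofReal (halfPlanePoisson x y t) * ENNReal.ofReal (f (t + ε * Complex.I)).re
      ≤ ENNReal.ofReal (Real.pi * (f (x + (y + ε) * Complex.I)).re) := by
  set φ : ℂ → ℂ := fun w => f (x + ε * Complex.I + y * invCayley w) with hφ
  have him : ∀ w : ℂ, 0 ≤ (invCayley w).im →
      0 < ((x : ℂ) + ε * Complex.I + y * invCayley w).im := by
    intro w hw
    simp
    positivity
  have hdat : ∀ w : ℂ, 1 - w ≠ 0 → 0 ≤ (invCayley w).im → DifferentiableAt ℂ φ w := by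
    intro w hw h
    have h1 : DifferentiableAt ℂ f ((x : ℂ) + ε * Complex.I + y * invCayley w) :=
      hf.differentiableAt ((isOpen_lt continuous_const Complex.continuous_im).mem_nhds (him w h))
    exact h1.comp w (((differentiableAt_invCayley hw).const_mul _).const_add _)
  have hφd : DifferentiableOn ℂ φ (Metric.ball 0 1) := fun w hw =>
    (hdat w (one_sub_ne_zero_of_mem_ball hw) (invCayley_im_pos hw).le).differentiableWithinAt
  have hφpos : ∀ w ∈ Metric.ball (0 : ℂ) 1, 0 ≤ (φ w).re := fun w hw =>
    hpos _ (him w (invCayley_im_pos hw).le)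
  set r : ℕ → ℝ := fun n => 1 - 1 / ((n : ℝ) + 2) with hr
  have hr0 : ∀ n, 0 < r n := by
    intro n
    have : 1 / ((n : ℝ) + 2) < 1 := by
      rw [div_lt_one (by positivity)]; linarith [(Nat.cast_nonneg n : (0 : ℝ) ≤ n)]
    simp only [hr]; linarith
  have hr1 : ∀ n, r n < 1 := by
    intro n
    have : 0 < 1 / ((n : ℝ) + 2) := by positivity
    simp only [hr]; linarith
  have hrt : Tendsto r atTop (𝓝 1) := by
    have : Tendsto (fun n : ℕ => 1 / ((n : ℝ) + 2)) atTop (𝓝 0) :=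
      tendsto_const_nhds.div_atTop (tendsto_atTop_add_const_right _ _ tendsto_natCast_atTop_atTop)
    simpa [hr] using this.const_sub 1
  have hcirc := fun n => lintegral_circle_re hφd hφpos (hr0 n) (hr1 n)
  have hφ0 : φ 0 = f (x + (y + ε) * Complex.I) := by
    simp only [hφ, invCayley]; congr 1; simp; ring
  have hlim : ∀ t : ℝ, Tendsto (fun n => ENNReal.ofReal
      (φ (r n * circleMap 0 1 (Real.pi + 2 * Real.arctan ((t - x) / y)))).re) atTop
      (𝓝 (ENNReal.ofReal (f (t + ε * Complex.I)).re)) := by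
    intro t
    set w := circleMap 0 1 (Real.pi + 2 * Real.arctan ((t - x) / y)) with hw
    have h1 : φ w = f (t + ε * Complex.I) := by
      simp only [hφ, hw, invCayley_circleMap_arctan]
      congr 1
      push_cast
      have : (y : ℂ) ≠ 0 := by exact_mod_cast hy.ne'
      field_simp
      ring
    have h2 : ContinuousAt φ w := by
      refine (hdat w (one_sub_circleMap_arctan_ne_zero _) ?_).continuousAt
      rw [hw, invCayley_circleMap_arctan]; simp
    have h3 : Tendsto (fun n => (r n : ℂ) * w) atTop (𝓝 w) := by
      have := ((Complex.continuous_ofReal.tendsto 1).comp hrt).mul_const w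
      simpa using this
    rw [← h1]
    exact (ENNReal.continuous_ofReal.tendsto _).comp
      ((Complex.continuous_re.tendsto _).comp (h2.tendsto.comp h3))
  have hcm : ∀ n, Continuous (fun θ : ℝ => φ (r n * circleMap 0 1 θ)) := by
    intro n
    refine hφd.continuousOn.comp_continuous (by fun_prop) fun θ => ?_
    simp [abs_of_pos (hr0 n), hr1 n]
  have key : ∀ n, ∫⁻ t, ENNReal.ofReal (halfPlanePoisson x y t) * ENNReal.ofReal
      (φ (r n * circleMap 0 1 (Real.pi + 2 * Real.arctan ((t - x) / y)))).re
      = ENNReal.ofReal (Real.pi * (φ 0).re) := by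
    intro n
    have h1 := hcirc n
    rw [restrict_Ioo_eq_restrict_Ioc.symm,
      lintegral_Ioo_eq_lintegral_halfPlanePoisson x hy, mul_assoc,
      ENNReal.ofReal_mul (by norm_num)] at h1
    simp only [ENNReal.ofReal_ofNat] at h1
    exact (ENNReal.mul_right_inj (by simp) (by simp)).1 h1
  calc ∫⁻ t, ENNReal.ofReal (halfPlanePoisson x y t) * ENNReal.ofReal (f (t + ε * Complex.I)).re
      = ∫⁻ t, liminf (fun n => ENNReal.ofReal (halfPlanePoisson x y t) * ENNReal.ofReal
        (φ (r n * circleMap 0 1 (Real.pi + 2 * Real.arctan ((t - x) / y)))).re) atTop := by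
        congr 1
        ext t
        exact (ENNReal.Tendsto.const_mul (hlim t) (Or.inr (by simp))).liminf_eq.symm
    _ ≤ liminf (fun n => ∫⁻ t, ENNReal.ofReal (halfPlanePoisson x y t) * ENNReal.ofReal
        (φ (r n * circleMap 0 1 (Real.pi + 2 * Real.arctan ((t - x) / y)))).re) atTop := by
        apply lintegral_liminf_le
        intro n
        have h1 := (continuous_halfPlanePoisson x hy).measurable
        have h2 : Measurable fun t : ℝ =>
            φ (r n * circleMap 0 1 (Real.pi + 2 * Real.arctan ((t - x) / y))) :=
          ((hcm n).comp (by fun_prop :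
            Continuous fun t : ℝ => Real.pi + 2 * Real.arctan ((t - x) / y))).measurable
        exact h1.ennreal_ofReal.mul (Complex.measurable_re.comp h2).ennreal_ofReal
    _ = ENNReal.ofReal (Real.pi * (f (x + (y + ε) * Complex.I)).re) := by
        simp only [key, hφ0]
        simp

/-- If `f` has nonnegative real part on the upper half plane and the real part is asymptotically
at least `c` along vertical lines ending in `E`, then the real part dominates `c` times the
harmonic measure of `E`. -/
lemma mul_lintegral_halfPlanePoisson_le {f : ℂ → ℂ}
    (hf : DifferentiableOn ℂ f {z | 0 < z.im}) (hpos : ∀ z : ℂ, 0 < z.im → 0 ≤ (f z).re)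
    {E : Set ℝ} {c : ℝ}
    (hlim : ∀ᵐ t : ℝ ∂(volume.restrict E),
      Tendsto (fun ε : ℝ => (f (t + ε * Complex.I)).re) (𝓝[>] 0) (𝓝 c))
    (x : ℝ) {y : ℝ} (hy : 0 < y) :
    ENNReal.ofReal c * ∫⁻ t in E, ENNReal.ofReal (halfPlanePoisson x y t)
      ≤ ENNReal.ofReal (Real.pi * (f (x + y * Complex.I)).re) := by
  set ε : ℕ → ℝ := fun n => 1 / ((n : ℝ) + 1) with hεdef
  have hε0 : ∀ n, 0 < ε n := fun n => by simp only [hεdef]; positivity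
  have hεt : Tendsto ε atTop (𝓝 0) := tendsto_one_div_add_atTop_nhds_zero_nat
  have hεw : Tendsto ε atTop (𝓝[>] 0) :=
    tendsto_nhdsWithin_iff.2 ⟨hεt, Eventually.of_forall hε0⟩
  have hopen : IsOpen {z : ℂ | 0 < z.im} := isOpen_lt continuous_const Complex.continuous_im
  have hrhs : Tendsto (fun n => ENNReal.ofReal (Real.pi * (f (x + (y + ε n) * Complex.I)).re))
      atTop (𝓝 (ENNReal.ofReal (Real.pi * (f (x + y * Complex.I)).re))) := by
    have h1 : ContinuousAt f (x + y * Complex.I) :=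
      (hf.differentiableAt (hopen.mem_nhds (by simpa using hy))).continuousAt
    have h2 : Tendsto (fun n => (x : ℂ) + (y + ε n) * Complex.I) atTop
        (𝓝 (x + y * Complex.I)) := by
      have := ((((Complex.continuous_ofReal.tendsto 0).comp hεt).const_add (y : ℂ)).mul_const
        Complex.I).const_add (x : ℂ)
      simpa using this
    exact (ENNReal.continuous_ofReal.tendsto _).comp
      (((Complex.continuous_re.tendsto _).comp (h1.tendsto.comp h2)).const_mul Real.pi)
  have hfm : ∀ n, Measurable fun t : ℝ => (f (t + ε n * Complex.I)).re := by
    intro n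
    have : Continuous fun t : ℝ => f (t + ε n * Complex.I) :=
      hf.continuousOn.comp_continuous (by fun_prop) fun t => by simpa using hε0 n
    exact Complex.measurable_re.comp this.measurable
  have hPm := (continuous_halfPlanePoisson x hy).measurable
  calc ENNReal.ofReal c * ∫⁻ t in E, ENNReal.ofReal (halfPlanePoisson x y t)
      = ∫⁻ t in E, ENNReal.ofReal (halfPlanePoisson x y t) * ENNReal.ofReal c := by
        rw [lintegral_mul_const _ (by fun_prop), mul_comm]
    _ = ∫⁻ t in E, liminf (fun n => ENNReal.ofReal (halfPlanePoisson x y t)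
          * ENNReal.ofReal (f (t + ε n * Complex.I)).re) atTop := by
        apply lintegral_congr_ae
        filter_upwards [hlim] with t ht
        exact (ENNReal.Tendsto.const_mul ((ENNReal.continuous_ofReal.tendsto _).comp
          (ht.comp hεw)) (Or.inr (by simp))).liminf_eq.symm
    _ ≤ ∫⁻ t, liminf (fun n => ENNReal.ofReal (halfPlanePoisson x y t)
          * ENNReal.ofReal (f (t + ε n * Complex.I)).re) atTop := setLIntegral_le_lintegral _ _
    _ ≤ liminf (fun n => ∫⁻ t, ENNReal.ofReal (halfPlanePoisson x y t)
          * ENNReal.ofReal (f (t + ε n * Complex.I)).re) atTop :=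
        lintegral_liminf_le fun n => hPm.ennreal_ofReal.mul (hfm n).ennreal_ofReal
    _ ≤ liminf (fun n => ENNReal.ofReal (Real.pi * (f (x + (y + ε n) * Complex.I)).re)) atTop :=
        liminf_le_liminf (Eventually.of_forall fun n =>
          lintegral_halfPlanePoisson_mul_shift_le hf hpos x hy (hε0 n))
    _ = ENNReal.ofReal (Real.pi * (f (x + y * Complex.I)).re) := hrhs.liminf_eq

lemma continuous_poissonKernel_circleMap {w : ℂ} (hw : w ∈ Metric.ball (0 : ℂ) 1) :
    Continuous fun θ : ℝ => poissonKernel 0 w (circleMap 0 1 θ) := by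
  unfold poissonKernel
  refine Continuous.div (by fun_prop) (by fun_prop) fun θ => ?_
  have h1 : ‖w‖ < 1 := by simpa using hw
  have h2 : circleMap 0 1 θ - 0 - (w - 0) ≠ 0 := by
    intro h
    rw [sub_zero, sub_zero, sub_eq_zero] at h
    rw [← h] at h1
    simp at h1
  positivity

lemma poissonKernel_circleMap_nonneg {w : ℂ} (hw : w ∈ Metric.ball (0 : ℂ) 1) (θ : ℝ) :
    0 ≤ poissonKernel 0 w (circleMap 0 1 θ) := by
  have h1 : ‖w‖ < 1 := by simpa using hw
  unfold poissonKernel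
  apply div_nonneg _ (by positivity)
  simp
  exact h1.le

/-- The Herglotz representation of a function with nonnegative real part on the unit disc. -/
lemma exists_measure_re_eq_integral_poissonKernel {φ : ℂ → ℂ}
    (hφ : DifferentiableOn ℂ φ (Metric.ball 0 1))
    (hpos : ∀ w ∈ Metric.ball (0 : ℂ) 1, 0 ≤ (φ w).re) :
    ∃ ν : Measure ℝ, IsFiniteMeasure ν ∧ ∀ w ∈ Metric.ball (0 : ℂ) 1,
      (φ w).re = ∫ θ, poissonKernel 0 w (circleMap 0 1 θ) ∂ν := by
  set r : ℕ → ℝ := fun n => 1 - 1 / ((n : ℝ) + 2) with hr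
  have hr0 : ∀ n, 0 < r n := by
    intro n
    have : 1 / ((n : ℝ) + 2) < 1 := by
      rw [div_lt_one (by positivity)]; linarith [(Nat.cast_nonneg n : (0 : ℝ) ≤ n)]
    simp only [hr]; linarith
  have hr1 : ∀ n, r n < 1 := by
    intro n
    have : 0 < 1 / ((n : ℝ) + 2) := by positivity
    simp only [hr]; linarith
  have hrt : Tendsto r atTop (𝓝 1) := by
    have : Tendsto (fun n : ℕ => 1 / ((n : ℝ) + 2)) atTop (𝓝 0) :=
      tendsto_const_nhds.div_atTop (tendsto_atTop_add_const_right _ _ tendsto_natCast_atTop_atTop)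
    simpa [hr] using this.const_sub 1
  have hmem : ∀ n, ∀ w ∈ Metric.closedBall (0 : ℂ) 1, (r n : ℂ) * w ∈ Metric.ball (0 : ℂ) 1 := by
    intro n w hw
    have h : ‖w‖ ≤ 1 := by simpa using hw
    simp only [Metric.mem_ball, dist_zero_right, norm_mul, Complex.norm_real, Real.norm_eq_abs,
      abs_of_pos (hr0 n)]
    nlinarith [norm_nonneg w, hr0 n, hr1 n]
  have hcm : ∀ n, Continuous (fun θ : ℝ => (φ (r n * circleMap 0 1 θ)).re) := by
    intro n
    refine Complex.continuous_re.comp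
      (hφ.continuousOn.comp_continuous (by fun_prop) fun θ => hmem n _ ?_)
    simp
  have hd : ∀ n, DifferentiableOn ℂ (fun w => φ (r n * w)) (Metric.closedBall 0 1) :=
    fun n => hφ.comp (by fun_prop) (hmem n)
  set dens : ℕ → ℝ → ENNReal := fun n θ => ENNReal.ofReal (φ (r n * circleMap 0 1 θ)).re with hdens
  have hdm : ∀ n, Measurable (dens n) := fun n => (hcm n).measurable.ennreal_ofReal
  set ν : ℕ → Measure ℝ := fun n =>
    (volume.restrict (Set.Ioc 0 (2 * Real.pi))).withDensity (dens n) with hν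
  have hmass : ∀ n, ν n Set.univ = ENNReal.ofReal (2 * Real.pi * (φ 0).re) := by
    intro n
    rw [hν, withDensity_apply _ MeasurableSet.univ, Measure.restrict_univ]
    exact lintegral_circle_re hφ hpos (hr0 n) (hr1 n)
  have hfin : ∀ n, IsFiniteMeasure (ν n) := fun n => ⟨by rw [hmass]; simp⟩
  set m : ℕ → FiniteMeasure ℝ := fun n => ⟨ν n, hfin n⟩ with hm
  have hK := isCompact_setOfPred_finiteMeasure_le_of_isCompact
    (2 * Real.pi * (φ 0).re).toNNReal (isCompact_Icc (a := (0 : ℝ)) (b := 2 * Real.pi))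
  obtain ⟨L, -, hL⟩ := hK.ultrafilter_le_nhds ((hyperfilter ℕ).map m) (by
    rw [Ultrafilter.coe_map, le_principal_iff, mem_map]
    refine Filter.mem_of_superset univ_mem fun n _ => ?_
    refine ⟨?_, ?_⟩
    · have : ((m n).mass : ENNReal) = ENNReal.ofReal (2 * Real.pi * (φ 0).re) := by
        rw [FiniteMeasure.ennreal_mass]; exact hmass n
      rw [ENNReal.ofReal, ENNReal.coe_inj] at this
      exact this.le
    · rw [← ENNReal.coe_eq_zero, FiniteMeasure.ennreal_coeFn_eq_coeFn_toMeasure]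
      change ν n _ = 0
      rw [hν, withDensity_apply _ measurableSet_Icc.compl, Measure.restrict_restrict
        measurableSet_Icc.compl]
      have : (Set.Icc (0 : ℝ) (2 * Real.pi))ᶜ ∩ Set.Ioc 0 (2 * Real.pi) = ∅ := by
        ext t; simp; intro h1 h2; exact h1 h2.le
      simp [this])
  have hLt : Tendsto m (hyperfilter ℕ : Filter ℕ) (𝓝 L) := hL
  have hLi := FiniteMeasure.tendsto_iff_forall_integral_tendsto.1 hLt
  refine ⟨ENNReal.ofReal (2 * Real.pi)⁻¹ • (L : Measure ℝ),
    Measure.smul_finite _ ENNReal.ofReal_ne_top, fun w hw => ?_⟩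
  have hPc := continuous_poissonKernel_circleMap hw
  have hbdd : ∃ C, ∀ θ : ℝ, ‖poissonKernel 0 w (circleMap 0 1 θ)‖ ≤ C := by
    have hper : Function.Periodic (fun θ : ℝ => poissonKernel 0 w (circleMap 0 1 θ))
        (2 * Real.pi) := fun θ => by simp [periodic_circleMap 0 1 θ]
    obtain ⟨C, hC⟩ := hper.compact_of_continuous (by positivity) hPc |>.isBounded.exists_norm_le
    exact ⟨C, fun θ => hC _ ⟨θ, rfl⟩⟩
  obtain ⟨C, hC⟩ := hbdd
  have h1 := hLi (BoundedContinuousFunction.ofNormedAddCommGroup _ hPc C hC)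
  simp only [BoundedContinuousFunction.coe_ofNormedAddCommGroup] at h1
  have h2 : ∀ n, ∫ θ, poissonKernel 0 w (circleMap 0 1 θ) ∂(m n : Measure ℝ)
      = 2 * Real.pi * (φ (r n * w)).re := by
    intro n
    change ∫ θ, poissonKernel 0 w (circleMap 0 1 θ) ∂(ν n) = _
    have hcl : DiffContOnCl ℂ (fun w => φ (r n * w)) (Metric.ball 0 1) :=
      DifferentiableOn.diffContOnCl ((hd n).mono Metric.closure_ball_subset_closedBall)
    have h3 := hcl.circleAverage_poissonKernel_smul hw
    have hci : CircleIntegrable (poissonKernel 0 w • fun w => φ (r n * w)) 0 1 := by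
      refine Continuous.intervalIntegrable ?_ _ _
      refine hPc.smul ((hφ.continuousOn.comp_continuous (by fun_prop) fun θ => hmem n _ ?_))
      simp
    have h4 := Complex.reCLM.circleAverage_comp_comm hci
    rw [h3, Real.circleAverage_def] at h4
    simp only [Function.comp_apply, Complex.reCLM_apply, smul_eq_mul, Pi.smul_apply',
      Complex.real_smul, Complex.re_ofReal_mul] at h4
    rw [hν, integral_withDensity_eq_integral_toReal_smul (hdm n)
      (ae_of_all _ fun θ => by simp [hdens]), ← h4,
      intervalIntegral.integral_of_le (by positivity), mul_inv_cancel_left₀ (by positivity)]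
    refine integral_congr_ae (ae_of_all _ fun θ => ?_)
    simp only [hdens, smul_eq_mul]
    rw [ENNReal.toReal_ofReal (hpos _ (hmem n _ (by simp))), mul_comm]
  have h3 : Tendsto (fun n => 2 * Real.pi * (φ (r n * w)).re) atTop
      (𝓝 (2 * Real.pi * (φ w).re)) := by
    have h4 : Tendsto (fun n => (r n : ℂ) * w) atTop (𝓝 w) := by
      have := ((Complex.continuous_ofReal.tendsto 1).comp hrt).mul_const w
      simpa using this
    have h5 : ContinuousAt φ w :=
      (hφ.differentiableAt (Metric.isOpen_ball.mem_nhds hw)).continuousAt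
    exact ((Complex.continuous_re.tendsto _).comp (h5.tendsto.comp h4)).const_mul _
  have hle : (hyperfilter ℕ : Filter ℕ) ≤ atTop := by
    rw [← Nat.cofinite_eq_atTop]; exact hyperfilter_le_cofinite
  have h4 := tendsto_nhds_unique (h1.congr h2) (h3.mono_left hle)
  rw [integral_smul_measure, h4, ENNReal.toReal_ofReal (by positivity), smul_eq_mul,
    inv_mul_cancel_left₀ (by positivity)]

lemma poissonKernel_eq_one {w : ℂ} {x y : ℝ} (hy : 0 < y)
    (hw : w = ((x : ℂ) + y * Complex.I - Complex.I) / (x + y * Complex.I + Complex.I)) :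
    poissonKernel 0 w 1 = y := by
  have h0 : (x : ℂ) + y * Complex.I + Complex.I ≠ 0 := by
    intro h
    have := congrArg Complex.im h
    simp at this
    linarith
  have h1 : (1 : ℂ) - w = 2 * Complex.I / (x + y * Complex.I + Complex.I) := by
    rw [hw]; field_simp; ring
  have hN : Complex.normSq ((x : ℂ) + y * Complex.I + Complex.I) ≠ 0 := by
    rwa [Ne, Complex.normSq_eq_zero]
  simp only [poissonKernel, sub_zero, h1, ← Complex.normSq_eq_norm_sq]
  rw [hw, Complex.normSq_div, Complex.normSq_div]
  field_simp
  simp [Complex.normSq_apply]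
  ring

lemma poissonKernel_eq_mul_halfPlanePoisson {w ζ : ℂ} {x y : ℝ} (hy : 0 < y)
    (hw : w = ((x : ℂ) + y * Complex.I - Complex.I) / (x + y * Complex.I + Complex.I))
    (s : ℝ) (hζ : ζ = ((s : ℂ) - Complex.I) / (s + Complex.I)) :
    poissonKernel 0 w ζ = (s ^ 2 + 1) * halfPlanePoisson x y s := by
  have h0 : (x : ℂ) + y * Complex.I + Complex.I ≠ 0 := by
    intro h
    have := congrArg Complex.im h
    simp at this
    linarith
  have hs : (s : ℂ) + Complex.I ≠ 0 := by
    intro h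
    have := congrArg Complex.im h
    simp at this
  have h1 : ζ - w = 2 * Complex.I * (s - (x + y * Complex.I)) /
      ((s + Complex.I) * (x + y * Complex.I + Complex.I)) := by
    rw [hw, hζ]
    generalize (x : ℂ) + y * Complex.I = z at h0
    field_simp
    ring
  have hN : Complex.normSq ((x : ℂ) + y * Complex.I + Complex.I) ≠ 0 := by
    rwa [Ne, Complex.normSq_eq_zero]
  have hD : Complex.normSq ((s : ℂ) - (x + y * Complex.I)) = (s - x) ^ 2 + y ^ 2 := by
    simp [Complex.normSq_apply]; ring
  have hAB : Complex.normSq ((x : ℂ) + y * Complex.I - Complex.I)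
      = Complex.normSq ((x : ℂ) + y * Complex.I + Complex.I) - 4 * y := by
    simp [Complex.normSq_apply]; ring
  have hS : Complex.normSq ((s : ℂ) - Complex.I) = s ^ 2 + 1 := by
    simp [Complex.normSq_apply]; ring
  have hS' : Complex.normSq ((s : ℂ) + Complex.I) = s ^ 2 + 1 := by
    simp [Complex.normSq_apply]; ring
  have hI : Complex.normSq (2 * Complex.I) = 4 := by simp [Complex.normSq_apply]; norm_num
  simp only [poissonKernel, sub_zero, h1, ← Complex.normSq_eq_norm_sq, halfPlanePoisson]
  rw [hw, hζ, Complex.normSq_div, Complex.normSq_div, Complex.normSq_div, Complex.normSq_mul,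
    Complex.normSq_mul (_ + _), hAB, hS, hS', hD, hI]
  generalize Complex.normSq ((x : ℂ) + y * Complex.I + Complex.I) = B at hN
  have hs1 : s ^ 2 + 1 ≠ 0 := by positivity
  field_simp
  ring

/-- The Herglotz representation of a function with nonnegative real part on the upper half
plane. -/
theorem exists_measure_re_eq_lintegral_halfPlanePoisson {f : ℂ → ℂ}
    (hf : DifferentiableOn ℂ f {z | 0 < z.im}) (hpos : ∀ z : ℂ, 0 < z.im → 0 ≤ (f z).re) :
    ∃ (ν : Measure ℝ) (c : ENNReal), c ≠ ⊤ ∧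
      ∫⁻ t, ENNReal.ofReal (t ^ 2 + 1)⁻¹ ∂ν ≠ ⊤ ∧
      ∀ x y : ℝ, 0 < y → ENNReal.ofReal (f (x + y * Complex.I)).re
        = c * ENNReal.ofReal y + ∫⁻ t, ENNReal.ofReal (halfPlanePoisson x y t) ∂ν := by
  have hopen : IsOpen {z : ℂ | 0 < z.im} := isOpen_lt continuous_const Complex.continuous_im
  have hφd : DifferentiableOn ℂ (fun w => f (invCayley w)) (Metric.ball 0 1) := fun w hw =>
    ((hf.differentiableAt (hopen.mem_nhds (invCayley_im_pos hw))).comp w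
      (differentiableAt_invCayley (one_sub_ne_zero_of_mem_ball hw))).differentiableWithinAt
  obtain ⟨ν₀, hfin, hν₀⟩ := exists_measure_re_eq_integral_poissonKernel hφd
    fun w hw => hpos _ (invCayley_im_pos hw)
  set A : Set ℝ := {θ | circleMap 0 1 θ = 1} with hA
  have hAm : MeasurableSet A :=
    (isClosed_eq (by fun_prop) continuous_const).measurableSet
  set T : ℝ → ℝ := fun θ => (invCayley (circleMap 0 1 θ)).re with hT
  have hTm : Measurable T := by
    have : Measurable invCayley := by unfold invCayley; fun_prop
    exact Complex.measurable_re.comp (this.comp (by fun_prop))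
  have hTζ : ∀ θ ∈ Aᶜ, circleMap 0 1 θ = ((T θ : ℂ) - Complex.I) / (T θ + Complex.I) := by
    intro θ hθ
    have hne : 1 - circleMap 0 1 θ ≠ 0 := by
      rw [sub_ne_zero]; exact fun h => hθ h.symm
    have him : (invCayley (circleMap 0 1 θ)).im = 0 := by
      rw [invCayley_im, Complex.normSq_eq_norm_sq]; simp
    have h1 : (T θ : ℂ) = invCayley (circleMap 0 1 θ) := by
      apply Complex.ext <;> simp [hT, him]
    rw [h1, invCayley]
    have h2 : Complex.I * (1 + circleMap 0 1 θ) / (1 - circleMap 0 1 θ) + Complex.I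
        = 2 * Complex.I / (1 - circleMap 0 1 θ) := by field_simp; ring
    rw [h2]
    field_simp
    ring
  set ν₁ : Measure ℝ := (ν₀.restrict Aᶜ).map T with hν₁
  have hw1 : Measurable fun t : ℝ => ENNReal.ofReal (t ^ 2 + 1) := by fun_prop
  have hint : ∀ h : ℝ → ENNReal, Measurable h →
      ∫⁻ t, h t ∂(ν₁.withDensity fun t => ENNReal.ofReal (t ^ 2 + 1))
        = ∫⁻ θ in Aᶜ, ENNReal.ofReal ((T θ) ^ 2 + 1) * h (T θ) ∂ν₀ := by
    intro h hh
    rw [lintegral_withDensity_eq_lintegral_mul _ hw1 hh, hν₁,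
      lintegral_map (hw1.mul hh) hTm]
    rfl
  refine ⟨ν₁.withDensity fun t => ENNReal.ofReal (t ^ 2 + 1), ν₀ A, measure_ne_top _ _, ?_, ?_⟩
  · rw [hint _ (by fun_prop)]
    have : ∀ s : ℝ, ENNReal.ofReal (s ^ 2 + 1) * ENNReal.ofReal (s ^ 2 + 1)⁻¹ = 1 := by
      intro s
      rw [← ENNReal.ofReal_mul (by positivity), mul_inv_cancel₀ (by positivity)]
      simp
    simp only [this]
    simp
  · intro x y hy
    set w : ℂ := ((x : ℂ) + y * Complex.I - Complex.I) / (x + y * Complex.I + Complex.I) with hw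
    have h0 : (x : ℂ) + y * Complex.I + Complex.I ≠ 0 := by
      intro h
      have := congrArg Complex.im h
      simp at this
      linarith
    have hwb : w ∈ Metric.ball (0 : ℂ) 1 := by
      have hN : 0 < Complex.normSq ((x : ℂ) + y * Complex.I + Complex.I) :=
        Complex.normSq_pos.2 h0
      have h1 : ‖w‖ ^ 2 < 1 := by
        rw [← Complex.normSq_eq_norm_sq, hw, Complex.normSq_div, div_lt_one hN]
        simp [Complex.normSq_apply]
        nlinarith
      have h2 : ‖w‖ < 1 := by nlinarith [norm_nonneg w]
      simpa using h2
    have hzw : invCayley w = x + y * Complex.I := by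
      have h1 : (1 : ℂ) - w = 2 * Complex.I / (x + y * Complex.I + Complex.I) := by
        rw [hw]; field_simp; ring
      rw [invCayley, h1, hw]
      generalize (x : ℂ) + y * Complex.I = z at h0
      field_simp
      ring
    have h1 := hν₀ w hwb
    rw [hzw] at h1
    have hPc := continuous_poissonKernel_circleMap hwb
    rw [h1, integral_eq_lintegral_of_nonneg_ae
      (ae_of_all _ (poissonKernel_circleMap_nonneg hwb)) hPc.aestronglyMeasurable,
      ENNReal.ofReal_toReal, ← lintegral_add_compl _ hAm,
      hint _ (continuous_halfPlanePoisson x hy).measurable.ennreal_ofReal]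
    · congr 1
      · rw [setLIntegral_congr_fun hAm (g := fun _ => ENNReal.ofReal y)]
        · simp [mul_comm]
        · intro θ hθ
          simp only
          rw [show circleMap 0 1 θ = 1 from hθ, poissonKernel_eq_one hy hw]
      · refine setLIntegral_congr_fun hAm.compl fun θ hθ => ?_
        rw [poissonKernel_eq_mul_halfPlanePoisson hy hw (T θ) (hTζ θ hθ),
          ENNReal.ofReal_mul (by positivity)]
    · have hbdd : ∃ C, ∀ θ : ℝ, ‖poissonKernel 0 w (circleMap 0 1 θ)‖ ≤ C := by
        have hper : Function.Periodic (fun θ : ℝ => poissonKernel 0 w (circleMap 0 1 θ))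
            (2 * Real.pi) := fun θ => by simp [periodic_circleMap 0 1 θ]
        obtain ⟨C, hC⟩ :=
          hper.compact_of_continuous (by positivity) hPc |>.isBounded.exists_norm_le
        exact ⟨C, fun θ => hC _ ⟨θ, rfl⟩⟩
      obtain ⟨C, hC⟩ := hbdd
      refine ((lintegral_mono fun θ => ENNReal.ofReal_le_ofReal
        ((Real.le_norm_self _).trans (hC θ))).trans_lt ?_).ne
      rw [lintegral_const]
      exact ENNReal.mul_lt_top (by simp) (measure_lt_top _ _)

lemma isLocallyFiniteMeasure_of_lintegral_inv_sq_add_one {ν : Measure ℝ}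
    (hν : ∫⁻ t, ENNReal.ofReal (t ^ 2 + 1)⁻¹ ∂ν ≠ ⊤) : IsLocallyFiniteMeasure ν := by
  refine ⟨fun x => ⟨Metric.ball x 1, Metric.ball_mem_nhds x one_pos, ?_⟩⟩
  have hε : (0 : ℝ) < ((|x| + 1) ^ 2 + 1)⁻¹ := by positivity
  have hsub : Metric.ball x 1 ⊆
      {t : ℝ | ENNReal.ofReal ((|x| + 1) ^ 2 + 1)⁻¹ ≤ ENNReal.ofReal (t ^ 2 + 1)⁻¹} := by
    intro t ht
    have h1 : |t - x| < 1 := by simpa [Real.dist_eq] using ht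
    have h2 : |t| ≤ |x| + 1 := by
      have := abs_add_le (t - x) x
      rw [sub_add_cancel] at this
      linarith
    have h3 : t ^ 2 ≤ (|x| + 1) ^ 2 := by
      rw [← sq_abs t]
      exact pow_le_pow_left₀ (abs_nonneg t) h2 2
    refine ENNReal.ofReal_le_ofReal (inv_anti₀ (by positivity) (by linarith))
  refine (measure_mono hsub).trans_lt ?_
  refine (meas_ge_le_lintegral_div (by fun_prop) (by simpa using hε) (by simp)).trans_lt ?_
  exact ENNReal.div_lt_top hν (by simpa using hε)

lemma setOf_le_halfPlanePoisson_inter_closedBall {x y r s : ℝ} (hy : 0 < y) (hs : 0 < s)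
    (hr : 0 < r) (hsy : s ≠ y⁻¹) :
    {t | s ≤ halfPlanePoisson x y t} ∩ Metric.closedBall x r = ∅ ∨
    ∃ ρ, 0 < ρ ∧ ρ ≤ r ∧
      {t | s ≤ halfPlanePoisson x y t} ∩ Metric.closedBall x r = Metric.closedBall x ρ := by
  have key : ∀ t, s ≤ halfPlanePoisson x y t ↔ (t - x) ^ 2 ≤ y / s - y ^ 2 := by
    intro t
    unfold halfPlanePoisson
    rw [le_div_iff₀ (by positivity), le_sub_iff_add_le, le_div_iff₀ hs, mul_comm]
  rcases lt_or_gt_of_ne hsy with h | h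
  · right
    have h1 : 0 < y / s - y ^ 2 := by
      rw [sub_pos, lt_div_iff₀ hs]
      have : s * y < 1 := by
        have := mul_lt_mul_of_pos_right h hy
        rwa [inv_mul_cancel₀ hy.ne'] at this
      nlinarith
    refine ⟨min (Real.sqrt (y / s - y ^ 2)) r, lt_min (Real.sqrt_pos.2 h1) hr,
      min_le_right _ _, ?_⟩
    ext t
    simp only [Set.mem_inter_iff, Set.mem_ofPred_eq, key, Metric.mem_closedBall, Real.dist_eq,
      le_min_iff, ← Real.sqrt_sq_eq_abs]
    rw [Real.sqrt_le_sqrt_iff h1.le]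
  · left
    ext t
    simp only [Set.mem_inter_iff, Set.mem_ofPred_eq, key, Set.mem_empty_iff_false, iff_false,
      not_and]
    intro h1
    exfalso
    have : y / s < y ^ 2 := by
      rw [div_lt_iff₀ hs]
      have : 1 < s * y := by
        have := mul_lt_mul_of_pos_right h hy
        rwa [inv_mul_cancel₀ hy.ne'] at this
      nlinarith
    nlinarith [sq_nonneg (t - x)]

lemma setLIntegral_closedBall_halfPlanePoisson_le {μ ν : Measure ℝ} {A : ENNReal} {x y r : ℝ}
    (hy : 0 < y) (hr : 0 < r)
    (h : ∀ ρ, 0 < ρ → ρ ≤ r → ν (Metric.closedBall x ρ) ≤ A * μ (Metric.closedBall x ρ)) :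
    ∫⁻ t in Metric.closedBall x r, ENNReal.ofReal (halfPlanePoisson x y t) ∂ν ≤
      A * ∫⁻ t in Metric.closedBall x r, ENNReal.ofReal (halfPlanePoisson x y t) ∂μ := by
  have hc := continuous_halfPlanePoisson x hy
  have hm : ∀ s, MeasurableSet {t | s ≤ halfPlanePoisson x y t} := fun s =>
    measurableSet_le measurable_const hc.measurable
  rw [lintegral_eq_lintegral_meas_le _ (ae_of_all _ fun t => (halfPlanePoisson_pos hy x t).le)
    hc.measurable.aemeasurable,
    lintegral_eq_lintegral_meas_le _ (ae_of_all _ fun t => (halfPlanePoisson_pos hy x t).le)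
    hc.measurable.aemeasurable]
  have hanti : ∀ κ : Measure ℝ, Antitone fun s => κ {t | s ≤ halfPlanePoisson x y t} :=
    fun κ s s' hs => measure_mono fun t ht => hs.trans ht
  rw [← lintegral_const_mul _ (hanti _).measurable]
  refine lintegral_mono_ae ?_
  have hne : ∀ᵐ s ∂(volume.restrict (Set.Ioi (0 : ℝ))), s ≠ y⁻¹ :=
    ae_restrict_of_ae (Measure.ae_ne volume _)
  filter_upwards [hne, ae_restrict_mem measurableSet_Ioi] with s hs hs0
  rw [Measure.restrict_apply (hm s), Measure.restrict_apply (hm s)]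
  rcases setOf_le_halfPlanePoisson_inter_closedBall (x := x) hy hs0 hr hs with h1 | ⟨ρ, h2, h3, h1⟩
  · simp [h1]
  · rw [h1]
    exact h ρ h2 h3

lemma halfPlanePoisson_le_mul_inv_sq_add_one {x y r t : ℝ} (hy : 0 < y) (hr : 0 < r)
    (ht : t ∉ Metric.closedBall x r) :
    halfPlanePoisson x y t ≤ y * (2 + (1 + 2 * x ^ 2) / r ^ 2) * (t ^ 2 + 1)⁻¹ := by
  have h1 : r < |t - x| := by simpa [Real.dist_eq] using ht
  have h2 : r ^ 2 ≤ (t - x) ^ 2 := by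
    rw [← sq_abs (t - x)]
    exact pow_le_pow_left₀ hr.le h1.le 2
  have h4 : 1 + 2 * x ^ 2 ≤ (1 + 2 * x ^ 2) / r ^ 2 * (t - x) ^ 2 := by
    rw [div_mul_eq_mul_div, le_div_iff₀ (by positivity)]
    exact mul_le_mul_of_nonneg_left h2 (by positivity)
  unfold halfPlanePoisson
  rw [← div_eq_mul_inv, div_le_div_iff₀ (by positivity) (by positivity), mul_assoc]
  refine mul_le_mul_of_nonneg_left ?_ hy.le
  have h5 : 0 ≤ (2 + (1 + 2 * x ^ 2) / r ^ 2) * y ^ 2 := by positivity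
  nlinarith [sq_nonneg (t - 2 * x)]

/-- The Poisson integral of a measure `ν` is controlled by that of `μ` along almost every vertical
line with respect to `μ`. -/
lemma ae_exists_lintegral_halfPlanePoisson_le {μ ν : Measure ℝ} [IsLocallyFiniteMeasure μ]
    (hμ : μ ≠ 0) {c : ENNReal} (hc : c ≠ ⊤)
    (hν : ∫⁻ t, ENNReal.ofReal (t ^ 2 + 1)⁻¹ ∂ν ≠ ⊤) :
    ∀ᵐ x ∂μ, ∃ C : ENNReal, C ≠ ⊤ ∧ ∀ y ∈ Set.Ioc (0 : ℝ) 1,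
      c * ENNReal.ofReal y + ∫⁻ t, ENNReal.ofReal (halfPlanePoisson x y t) ∂ν ≤
        C * ∫⁻ t, ENNReal.ofReal (halfPlanePoisson x y t) ∂μ := by
  have := isLocallyFiniteMeasure_of_lintegral_inv_sq_add_one hν
  filter_upwards [Besicovitch.ae_tendsto_rnDeriv ν μ, Measure.rnDeriv_lt_top ν μ] with x hx hx'
  obtain ⟨A, hA1, hA2⟩ := exists_between hx'
  obtain ⟨r, hr, hrA⟩ : ∃ r : ℝ, 0 < r ∧ ∀ ρ, 0 < ρ → ρ ≤ r →
      ν (Metric.closedBall x ρ) ≤ A * μ (Metric.closedBall x ρ) := by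
    obtain ⟨u, hu, hu'⟩ := mem_nhdsGT_iff_exists_Ioc_subset.1 (hx.eventually (gt_mem_nhds hA1))
    refine ⟨u, hu, fun ρ h0 h1 => ?_⟩
    have h2 : ν (Metric.closedBall x ρ) / μ (Metric.closedBall x ρ) < A := hu' ⟨h0, h1⟩
    exact (ENNReal.div_le_iff_le_mul (Or.inr hA2.ne)
      (Or.inl (isCompact_closedBall x ρ).measure_lt_top.ne)).1 h2.le |>.trans le_rfl
  set K : ENNReal := ENNReal.ofReal (2 + (1 + 2 * x ^ 2) / r ^ 2) *
    ∫⁻ t, ENNReal.ofReal (t ^ 2 + 1)⁻¹ ∂ν with hK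
  have hK' : K ≠ ⊤ := ENNReal.mul_ne_top (by simp) hν
  set m : ENNReal := min 1 (∫⁻ t, ENNReal.ofReal ((t - x) ^ 2 + 1)⁻¹ ∂μ) with hm
  have hm0 : m ≠ 0 := by
    refine (lt_min one_pos ?_).ne'
    rw [lintegral_pos_iff_support (by fun_prop)]
    have : (Function.support fun t : ℝ => ENNReal.ofReal ((t - x) ^ 2 + 1)⁻¹) = Set.univ := by
      ext t
      have : 0 < (t - x) ^ 2 + 1 := by positivity
      simpa using this
    rw [this]
    exact Measure.measure_univ_pos.2 hμ
  have hm1 : m ≠ ⊤ := ne_top_of_le_ne_top ENNReal.one_ne_top (min_le_left _ _)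
  refine ⟨A + (c + K) / m, by finiteness, fun y hy => ?_⟩
  have hlow : m * ENNReal.ofReal y ≤ ∫⁻ t, ENNReal.ofReal (halfPlanePoisson x y t) ∂μ := by
    refine (mul_le_mul_left (min_le_right _ _) _).trans ?_
    rw [← lintegral_mul_const _ (by fun_prop)]
    refine lintegral_mono fun t => ?_
    rw [← ENNReal.ofReal_mul (by positivity)]
    refine ENNReal.ofReal_le_ofReal ?_
    unfold halfPlanePoisson
    rw [inv_mul_eq_div]
    have := hy.1
    have : y ^ 2 ≤ 1 := pow_le_one₀ hy.1.le hy.2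
    gcongr
  have hfar : ∫⁻ t in (Metric.closedBall x r)ᶜ, ENNReal.ofReal (halfPlanePoisson x y t) ∂ν ≤
      K * ENNReal.ofReal y := by
    calc _ ≤ ∫⁻ t in (Metric.closedBall x r)ᶜ, ENNReal.ofReal y *
          ENNReal.ofReal (2 + (1 + 2 * x ^ 2) / r ^ 2) * ENNReal.ofReal (t ^ 2 + 1)⁻¹ ∂ν := by
          refine setLIntegral_mono' Metric.isClosed_closedBall.measurableSet.compl fun t ht => ?_
          have h0 := hy.1.le
          rw [← ENNReal.ofReal_mul (by positivity), ← ENNReal.ofReal_mul (by positivity)]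
          exact ENNReal.ofReal_le_ofReal (halfPlanePoisson_le_mul_inv_sq_add_one hy.1 hr ht)
      _ ≤ ∫⁻ t, ENNReal.ofReal y *
          ENNReal.ofReal (2 + (1 + 2 * x ^ 2) / r ^ 2) * ENNReal.ofReal (t ^ 2 + 1)⁻¹ ∂ν :=
          setLIntegral_le_lintegral _ _
      _ = K * ENNReal.ofReal y := by
          rw [lintegral_const_mul _ (by fun_prop), hK]; ring
  calc c * ENNReal.ofReal y + ∫⁻ t, ENNReal.ofReal (halfPlanePoisson x y t) ∂ν
      = c * ENNReal.ofReal y +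
        (∫⁻ t in Metric.closedBall x r, ENNReal.ofReal (halfPlanePoisson x y t) ∂ν +
        ∫⁻ t in (Metric.closedBall x r)ᶜ, ENNReal.ofReal (halfPlanePoisson x y t) ∂ν) := by
        rw [lintegral_add_compl _ Metric.isClosed_closedBall.measurableSet]
    _ ≤ c * ENNReal.ofReal y +
        (A * ∫⁻ t in Metric.closedBall x r, ENNReal.ofReal (halfPlanePoisson x y t) ∂μ +
          K * ENNReal.ofReal y) := by
        gcongr
        exact setLIntegral_closedBall_halfPlanePoisson_le hy.1 hr hrA
    _ ≤ c * ENNReal.ofReal y +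
        (A * ∫⁻ t, ENNReal.ofReal (halfPlanePoisson x y t) ∂μ + K * ENNReal.ofReal y) := by
        gcongr
        exact Measure.restrict_le_self
    _ = A * ∫⁻ t, ENNReal.ofReal (halfPlanePoisson x y t) ∂μ +
        (c + K) / m * (m * ENNReal.ofReal y) := by
        rw [← mul_assoc ((c + K) / m), ENNReal.div_mul_cancel hm0 hm1]; ring
    _ ≤ _ := by
        rw [add_mul]
        gcongr

lemma ofReal_sub_ne_zero_of_im_pos {z : ℂ} (hz : 0 < z.im) (t : ℝ) : (t : ℂ) - z ≠ 0 := by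
  intro h
  have := congrArg Complex.im h
  simp at this
  exact hz.ne' this

lemma normSq_ofReal_sub (t : ℝ) (z : ℂ) :
    Complex.normSq ((t : ℂ) - z) = (t - z.re) ^ 2 + z.im ^ 2 := by
  rw [Complex.normSq_apply]; simp; ring

lemma sq_add_one_le_mul_normSq {δ R : ℝ} (hδ : 0 < δ) {z : ℂ} (hz : δ ≤ z.im) (hR : ‖z‖ ≤ R)
    (t : ℝ) : t ^ 2 + 1 ≤ (2 + (2 * R ^ 2 + 1) / δ ^ 2) * Complex.normSq ((t : ℂ) - z) := by
  rw [normSq_ofReal_sub]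
  have h1 : z.re ^ 2 ≤ R ^ 2 := by
    rw [← sq_abs z.re]
    exact pow_le_pow_left₀ (abs_nonneg _) ((Complex.abs_re_le_norm z).trans hR) 2
  have h2 : δ ^ 2 ≤ z.im ^ 2 := pow_le_pow_left₀ hδ.le hz 2
  have h3 : 2 * R ^ 2 + 1 ≤ (2 * R ^ 2 + 1) / δ ^ 2 * ((t - z.re) ^ 2 + z.im ^ 2) := by
    rw [div_mul_eq_mul_div, le_div_iff₀ (by positivity)]
    exact mul_le_mul_of_nonneg_left (by nlinarith [sq_nonneg (t - z.re)]) (by positivity)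
  nlinarith [sq_nonneg (t - 2 * z.re), sq_nonneg z.im]

lemma differentiableOn_integral_cauchy {κ : Measure ℝ} {u v : ℝ → ℂ}
    (hu : AEStronglyMeasurable u κ) (hu' : Integrable (fun t => ‖u t‖ * (t ^ 2 + 1)⁻¹) κ)
    (hint : ∀ z : ℂ, 0 < z.im → Integrable (fun t : ℝ => u t * ((t : ℂ) - z)⁻¹ - v t) κ) :
    DifferentiableOn ℂ (fun z => ∫ t : ℝ, (u t * ((t : ℂ) - z)⁻¹ - v t) ∂κ) {z | 0 < z.im} := by
  intro z hz
  replace hz : 0 < z.im := hz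
  have hball : ∀ w ∈ Metric.ball z (z.im / 2), z.im / 2 ≤ w.im := by
    intro w hw
    have h1 : ‖w - z‖ < z.im / 2 := by simpa [dist_eq_norm] using hw
    have h2 := (abs_le.1 (Complex.abs_im_le_norm (w - z))).1
    simp at h2
    linarith
  have hball' : ∀ w ∈ Metric.ball z (z.im / 2), ‖w‖ ≤ ‖z‖ + z.im / 2 := by
    intro w hw
    have h1 : ‖w - z‖ < z.im / 2 := by simpa [dist_eq_norm] using hw
    have := norm_add_le (w - z) z
    rw [sub_add_cancel] at this
    linarith
  set K : ℝ := 2 + (2 * (‖z‖ + z.im / 2) ^ 2 + 1) / (z.im / 2) ^ 2 with hK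
  refine (hasDerivAt_integral_of_dominated_loc_of_deriv_le
    (F := fun (z : ℂ) (t : ℝ) => u t * ((t : ℂ) - z)⁻¹ - v t)
    (F' := fun (z : ℂ) (t : ℝ) => u t * (((t : ℂ) - z) ^ 2)⁻¹)
    (bound := fun t => K * (‖u t‖ * (t ^ 2 + 1)⁻¹))
    (Metric.ball_mem_nhds z (half_pos hz)) ?_ (hint z hz) ?_ ?_ (hu'.const_mul K)
    ?_).2.differentiableAt.differentiableWithinAt
  · filter_upwards [Metric.ball_mem_nhds z (half_pos hz)] with w hw
    exact (hint w ((half_pos hz).trans_le (hball w hw))).aestronglyMeasurable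
  · exact hu.mul (Measurable.aestronglyMeasurable (by fun_prop))
  · refine ae_of_all _ fun t w hw => ?_
    have h1 := sq_add_one_le_mul_normSq (half_pos hz) (hball w hw) (hball' w hw) t
    have h2 := ofReal_sub_ne_zero_of_im_pos ((half_pos hz).trans_le (hball w hw)) t
    have h3 := Complex.normSq_pos.2 h2
    rw [norm_mul, norm_inv, norm_pow, ← Complex.normSq_eq_norm_sq, mul_left_comm]
    refine mul_le_mul_of_nonneg_left ?_ (norm_nonneg _)
    rw [← div_eq_mul_inv, inv_eq_one_div, div_le_div_iff₀ h3 (by positivity), one_mul]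
    exact h1
  · refine ae_of_all _ fun t w hw => ?_
    have h2 := ofReal_sub_ne_zero_of_im_pos ((half_pos hz).trans_le (hball w hw)) t
    have h3 := (((hasDerivAt_id w).const_sub (t : ℂ)).inv h2).const_mul (u t)
    convert h3.sub_const (v t) using 1
    · rfl
    · simp

lemma inv_ofReal_sub_im (x y t : ℝ) :
    (((t : ℂ) - (x + y * Complex.I))⁻¹).im = halfPlanePoisson x y t := by
  rw [Complex.inv_im, normSq_ofReal_sub]
  simp [halfPlanePoisson]

lemma inv_ofReal_sub_re (x y t : ℝ) :
    (((t : ℂ) - (x + y * Complex.I))⁻¹).re = (t - x) / ((t - x) ^ 2 + y ^ 2) := by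
  rw [Complex.inv_re, normSq_ofReal_sub]
  simp

lemma integrable_herglotzFn_integrand {μ : Measure ℝ}
    (hμ : Integrable (fun t : ℝ => (t ^ 2 + 1)⁻¹) μ) {z : ℂ} (hz : 0 < z.im) :
    Integrable (fun t : ℝ => ((t : ℂ) - z)⁻¹ - (t : ℂ) / ((t : ℂ) ^ 2 + 1)) μ := by
  refine (hμ.const_mul (‖1 + z ^ 2‖ / z.im + ‖z‖)).mono'
    (Measurable.aestronglyMeasurable (by fun_prop)) (ae_of_all _ fun t => ?_)
  have h1 := ofReal_sub_ne_zero_of_im_pos hz t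
  have h0 : (0 : ℝ) < t ^ 2 + 1 := by positivity
  have h2 : (t : ℂ) ^ 2 + 1 ≠ 0 := by exact_mod_cast h0.ne'
  have h3 : ((t : ℂ) - z)⁻¹ - (t : ℂ) / ((t : ℂ) ^ 2 + 1) =
      (1 + z ^ 2 + z * (t - z)) * ((t : ℂ) - z)⁻¹ * ((t : ℂ) ^ 2 + 1)⁻¹ := by
    field_simp
    ring
  have h4 : ‖(t : ℂ) ^ 2 + 1‖ = t ^ 2 + 1 := by
    have : (t : ℂ) ^ 2 + 1 = ((t ^ 2 + 1 : ℝ) : ℂ) := by push_cast; rfl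
    rw [this, Complex.norm_real, Real.norm_of_nonneg h0.le]
  rw [h3, norm_mul, norm_mul, norm_inv, norm_inv, h4]
  refine mul_le_mul_of_nonneg_right ?_ (by positivity)
  have h5 : z.im ≤ ‖(t : ℂ) - z‖ := by
    have := Complex.abs_im_le_norm ((t : ℂ) - z)
    simp only [Complex.sub_im, Complex.ofReal_im, zero_sub, abs_neg] at this
    exact (le_abs_self _).trans this
  rw [← div_eq_mul_inv, div_le_iff₀ (norm_pos_iff.2 h1)]
  refine (norm_add_le _ _).trans ?_
  rw [norm_mul, add_mul]
  gcongr
  rw [div_mul_eq_mul_div, le_div_iff₀ hz]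
  exact mul_le_mul_of_nonneg_left h5 (norm_nonneg _)

lemma differentiableOn_herglotzFn {μ : Measure ℝ}
    (hμ : Integrable (fun t : ℝ => (t ^ 2 + 1)⁻¹) μ) (a b : ℝ) :
    DifferentiableOn ℂ (herglotzFn μ a b) {z | 0 < z.im} := by
  have h := differentiableOn_integral_cauchy (κ := μ) (u := fun _ => 1)
    (v := fun t => (t : ℂ) / ((t : ℂ) ^ 2 + 1)) aestronglyMeasurable_const (by simpa using hμ)
    (fun z hz => by simpa using integrable_herglotzFn_integrand hμ hz)
  simp only [one_mul] at h
  exact DifferentiableOn.add (by fun_prop) h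

lemma lintegral_halfPlanePoisson_le_herglotzFn_im {μ : Measure ℝ}
    (hμ : Integrable (fun t : ℝ => (t ^ 2 + 1)⁻¹) μ) (a : ℝ) {b : ℝ} (hb : 0 ≤ b) (x : ℝ) {y : ℝ}
    (hy : 0 < y) : ∫⁻ t, ENNReal.ofReal (halfPlanePoisson x y t) ∂μ ≤
      ENNReal.ofReal (herglotzFn μ a b (x + y * Complex.I)).im := by
  have hint := integrable_herglotzFn_integrand hμ (z := x + y * Complex.I) (by simpa using hy)
  have him : ∀ t : ℝ, (((t : ℂ) - (x + y * Complex.I))⁻¹ - (t : ℂ) / ((t : ℂ) ^ 2 + 1)).im =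
      halfPlanePoisson x y t := by
    intro t
    have : (t : ℂ) / ((t : ℂ) ^ 2 + 1) = ((t / (t ^ 2 + 1) : ℝ) : ℂ) := by push_cast; rfl
    rw [Complex.sub_im, inv_ofReal_sub_im, this, Complex.ofReal_im, sub_zero]
  have hint' : Integrable (halfPlanePoisson x y) μ := by
    refine (Complex.imCLM.integrable_comp hint).congr (ae_of_all _ fun t => ?_)
    exact him t
  have hval : (herglotzFn μ a b (x + y * Complex.I)).im =
      b * y + ∫ t, halfPlanePoisson x y t ∂μ := by
    unfold herglotzFn
    have := Complex.imCLM.integral_comp_comm hint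
    simp only [Complex.imCLM_apply, him] at this
    rw [Complex.add_im, ← this]
    simp
  rw [hval, ← ofReal_integral_eq_lintegral_ofReal hint'
    (ae_of_all _ fun t => (halfPlanePoisson_pos hy x t).le)]
  exact ENNReal.ofReal_le_ofReal (by nlinarith [mul_nonneg hb hy.le])

lemma herglotzFn_im_pos {μ : Measure ℝ} (hμ0 : μ ≠ 0)
    (hμ : Integrable (fun t : ℝ => (t ^ 2 + 1)⁻¹) μ) (a : ℝ) {b : ℝ} (hb : 0 ≤ b) {z : ℂ}
    (hz : 0 < z.im) : 0 < (herglotzFn μ a b z).im := by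
  have h := lintegral_halfPlanePoisson_le_herglotzFn_im hμ a hb z.re hz
  rw [Complex.re_add_im] at h
  rw [← ENNReal.ofReal_pos]
  refine lt_of_lt_of_le ?_ h
  have hc := continuous_halfPlanePoisson z.re hz
  rw [lintegral_pos_iff_support hc.measurable.ennreal_ofReal]
  have : (Function.support fun t : ℝ => ENNReal.ofReal (halfPlanePoisson z.re z.im t)) =
      Set.univ := by
    ext t
    simpa using halfPlanePoisson_pos hz z.re t
  rw [this]
  exact Measure.measure_univ_pos.2 hμ0

/-- The Cauchy transform of a function on the real line. -/
noncomputable def cauchyTransform (g : ℝ → ℝ) (z : ℂ) : ℂ := ∫ t : ℝ, (g t : ℂ) * ((t : ℂ) - z)⁻¹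

lemma integrable_mul_inv_ofReal_sub {g : ℝ → ℝ} (hg : Integrable g) {z : ℂ} (hz : 0 < z.im) :
    Integrable (fun t : ℝ => (g t : ℂ) * ((t : ℂ) - z)⁻¹) := by
  refine (hg.norm.mul_const z.im⁻¹).mono'
    (hg.ofReal.aestronglyMeasurable.mul (Measurable.aestronglyMeasurable (by fun_prop)))
    (ae_of_all _ fun t => ?_)
  rw [norm_mul, norm_inv, Complex.norm_real]
  refine mul_le_mul_of_nonneg_left (inv_anti₀ hz ?_) (norm_nonneg _)
  have := Complex.abs_im_le_norm ((t : ℂ) - z)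
  simp only [Complex.sub_im, Complex.ofReal_im, zero_sub, abs_neg] at this
  exact (le_abs_self _).trans this

lemma differentiableOn_cauchyTransform {g : ℝ → ℝ} (hg : Integrable g) :
    DifferentiableOn ℂ (cauchyTransform g) {z | 0 < z.im} := by
  have h := differentiableOn_integral_cauchy (κ := volume) (u := fun t => (g t : ℂ))
    (v := fun _ => 0) hg.ofReal.aestronglyMeasurable ?_
    (fun z hz => by simpa using integrable_mul_inv_ofReal_sub hg hz)
  · simp only [sub_zero] at h
    exact h
  · refine hg.norm.mono' ?_ (ae_of_all _ fun t => ?_)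
    · exact hg.ofReal.aestronglyMeasurable.norm.mul (Measurable.aestronglyMeasurable (by fun_prop))
    · rw [norm_mul, norm_norm, Complex.norm_real]
      refine mul_le_of_le_one_right (norm_nonneg _) ?_
      rw [norm_inv, Real.norm_of_nonneg (by positivity)]
      exact inv_le_one_of_one_le₀ (by nlinarith [sq_nonneg t])

lemma cauchyTransform_im {g : ℝ → ℝ} (hg : Integrable g) (x : ℝ) {y : ℝ} (hy : 0 < y) :
    (cauchyTransform g (x + y * Complex.I)).im = ∫ t, g t * halfPlanePoisson x y t := by
  have := Complex.imCLM.integral_comp_comm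
    (integrable_mul_inv_ofReal_sub hg (z := x + y * Complex.I) (by simpa using hy))
  simp only [Complex.imCLM_apply, Complex.im_ofReal_mul, inv_ofReal_sub_im] at this
  exact this.symm

lemma cauchyTransform_re {g : ℝ → ℝ} (hg : Integrable g) (x : ℝ) {y : ℝ} (hy : 0 < y) :
    (cauchyTransform g (x + y * Complex.I)).re =
      ∫ t, g t * ((t - x) / ((t - x) ^ 2 + y ^ 2)) := by
  have := Complex.reCLM.integral_comp_comm
    (integrable_mul_inv_ofReal_sub hg (z := x + y * Complex.I) (by simpa using hy))
  simp only [Complex.reCLM_apply, Complex.re_ofReal_mul, inv_ofReal_sub_re] at this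
  exact this.symm

lemma integral_halfPlanePoisson_and_integrable (x : ℝ) {y : ℝ} (hy : 0 < y) :
    Integrable (halfPlanePoisson x y) ∧ ∫ t, halfPlanePoisson x y t = Real.pi := by
  have h : halfPlanePoisson x y = fun t => y⁻¹ * (1 + (y⁻¹ * (t - x)) ^ 2)⁻¹ := by
    ext t
    unfold halfPlanePoisson
    field_simp
    ring
  have h1 : Integrable fun t : ℝ => (1 + (y⁻¹ * t) ^ 2)⁻¹ :=
    integrable_inv_one_add_sq.comp_mul_left' (inv_ne_zero hy.ne')
  have h2 : Integrable fun t : ℝ => (1 + (y⁻¹ * (t - x)) ^ 2)⁻¹ := h1.comp_sub_right x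
  refine ⟨h ▸ h2.const_mul _, ?_⟩
  rw [h, integral_const_mul, integral_sub_right_eq_self (fun t : ℝ => (1 + (y⁻¹ * t) ^ 2)⁻¹) x,
    Measure.integral_comp_mul_left (fun t : ℝ => (1 + t ^ 2)⁻¹), integral_univ_inv_one_add_sq,
    inv_inv, abs_of_pos hy, smul_eq_mul, inv_mul_cancel_left₀ hy.ne']

lemma lintegral_halfPlanePoisson (x : ℝ) {y : ℝ} (hy : 0 < y) :
    ∫⁻ t, ENNReal.ofReal (halfPlanePoisson x y t) = ENNReal.ofReal Real.pi := by
  obtain ⟨h1, h2⟩ := integral_halfPlanePoisson_and_integrable x hy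
  rw [← ofReal_integral_eq_lintegral_ofReal h1
    (ae_of_all _ fun t => (halfPlanePoisson_pos hy x t).le), h2]

lemma half_mul_sin_le_sin_add {α β : ℝ} (h0 : 0 < α) (hpi : α < Real.pi) (h1 : |β| ≤ α / 2)
    (h2 : |β| ≤ (Real.pi - α) / 2) : 1 / 2 * Real.sin α ≤ Real.sin (α + β) := by
  have hs : 0 ≤ Real.sin (α / 2) := Real.sin_nonneg_of_nonneg_of_le_pi (by linarith) (by linarith)
  have hc : 0 ≤ Real.cos (α / 2) := Real.cos_nonneg_of_mem_Icc ⟨by linarith, by linarith⟩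
  have hs1 := Real.sin_le_one (α / 2)
  have hc1 := Real.cos_le_one (α / 2)
  have hα : Real.sin α = 2 * Real.sin (α / 2) * Real.cos (α / 2) := by
    rw [← Real.sin_two_mul, mul_div_cancel₀ α two_ne_zero]
  have hβ1 := abs_le.1 h1
  have hβ2 := abs_le.1 h2
  rcases le_total (α + β) (Real.pi / 2) with h | h
  · have : Real.sin (α / 2) ≤ Real.sin (α + β) :=
      Real.sin_le_sin_of_le_of_le_pi_div_two (by linarith) h (by linarith)
    nlinarith
  · have : Real.sin (Real.pi / 2 - α / 2) ≤ Real.sin (Real.pi - (α + β)) :=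
      Real.sin_le_sin_of_le_of_le_pi_div_two (by linarith) (by linarith) (by linarith)
    rw [Real.sin_pi_sub, Real.sin_pi_div_two_sub] at this
    nlinarith

lemma mem_slitPlane_of_im_pos {z : ℂ} (hz : 0 < z.im) : z ∈ Complex.slitPlane :=
  Complex.mem_slitPlane_iff.2 (Or.inr hz.ne')

lemma arg_pos_of_im_pos {z : ℂ} (hz : 0 < z.im) : 0 < z.arg := by
  refine lt_of_le_of_ne (Complex.arg_nonneg_iff.2 hz.le) fun h => ?_
  have := (Complex.arg_eq_zero_iff.1 h.symm).2
  exact hz.ne' this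

lemma arg_lt_pi_of_im_pos {z : ℂ} (hz : 0 < z.im) : z.arg < Real.pi :=
  Complex.arg_lt_pi_iff.2 (Or.inr hz.ne')

lemma ne_zero_of_im_pos {z : ℂ} (hz : 0 < z.im) : z ≠ 0 := by
  rintro rfl
  simp at hz

section Herglotz

variable {F : ℂ → ℂ}

lemma one_le_re_one_add_I_div {w : ℂ} (hw : 0 < w.im) : 1 ≤ (1 + Complex.I / w).re := by
  have : 0 ≤ w.im / Complex.normSq w := div_nonneg hw.le (Complex.normSq_nonneg _)
  simpa [Complex.div_re] using this

/-- A Herglotz function stays away from zero along almost every vertical line. -/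
lemma ae_exists_le_norm (hF : DifferentiableOn ℂ F {z | 0 < z.im})
    (hFim : ∀ z : ℂ, 0 < z.im → 0 < (F z).im) :
    ∀ᵐ t : ℝ, ∃ δ : ℝ, 0 < δ ∧ ∀ y ∈ Set.Ioc (0 : ℝ) 1, δ ≤ ‖F (t + y * Complex.I)‖ := by
  have hdiff : DifferentiableOn ℂ (fun z => Complex.log (1 + Complex.I / F z)) {z | 0 < z.im} := by
    refine DifferentiableOn.clog (DifferentiableOn.const_add _ (DifferentiableOn.div
      (differentiableOn_const _) hF fun z hz => ne_zero_of_im_pos (hFim z hz))) fun z hz => ?_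
    exact Complex.mem_slitPlane_iff.2
      (Or.inl (one_pos.trans_le (one_le_re_one_add_I_div (hFim z hz))))
  have hpos : ∀ z : ℂ, 0 < z.im → 0 ≤ (Complex.log (1 + Complex.I / F z)).re := by
    intro z hz
    rw [Complex.log_re]
    exact Real.log_nonneg ((one_le_re_one_add_I_div (hFim z hz)).trans (Complex.re_le_norm _))
  obtain ⟨ν, c, hc, hν, hrep⟩ := exists_measure_re_eq_lintegral_halfPlanePoisson hdiff hpos
  filter_upwards [ae_exists_lintegral_halfPlanePoisson_le (μ := volume)
    (Measure.measure_univ_pos.1 (by simp)) hc hν] with x ⟨C, hC, hx⟩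
  set L : ℝ := (C * ENNReal.ofReal Real.pi).toReal with hL
  refine ⟨(Real.exp L + 1)⁻¹, by positivity, fun y hy => ?_⟩
  have hz : 0 < ((x : ℂ) + y * Complex.I).im := by simpa using hy.1
  have h1 := hx y hy
  rw [← hrep x y hy.1, lintegral_halfPlanePoisson x hy.1,
    ENNReal.ofReal_le_iff_le_toReal (ENNReal.mul_ne_top hC (by simp)), ← hL, Complex.log_re] at h1
  have h2 := hFim _ hz
  generalize F (x + y * Complex.I) = w at h1 h2
  have h3 : 0 < ‖1 + Complex.I / w‖ :=
    one_pos.trans_le ((one_le_re_one_add_I_div h2).trans (Complex.re_le_norm _))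
  rw [Real.log_le_iff_le_exp h3] at h1
  have h4 : ‖w‖⁻¹ ≤ Real.exp L + 1 := by
    have := norm_sub_le (1 + Complex.I / w) 1
    rw [add_sub_cancel_left, norm_div, Complex.norm_I, one_div, norm_one] at this
    linarith
  exact inv_le_of_inv_le₀ (norm_pos_iff.2 (ne_zero_of_im_pos h2)) h4

lemma ae_tendsto_arg (hF : DifferentiableOn ℂ F {z | 0 < z.im})
    (hFim : ∀ z : ℂ, 0 < z.im → 0 < (F z).im) {E : Set ℝ}
    (hlim : ∀ᵐ t : ℝ ∂(volume.restrict E),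
      Tendsto (fun y : ℝ => (F (t + y * Complex.I)).re) (𝓝[>] 0) (𝓝 0)) :
    ∀ᵐ t : ℝ ∂(volume.restrict E),
      Tendsto (fun y : ℝ => (F (t + y * Complex.I)).arg) (𝓝[>] 0) (𝓝 (Real.pi / 2)) := by
  filter_upwards [hlim, ae_restrict_of_ae (ae_exists_le_norm hF hFim)] with t ht ⟨δ, hδ, hδ'⟩
  have hev : ∀ᶠ y : ℝ in 𝓝[>] 0, y ∈ Set.Ioc (0 : ℝ) 1 := Ioc_mem_nhdsGT one_pos
  have h1 : Tendsto (fun y : ℝ => (F (t + y * Complex.I)).re / ‖F (t + y * Complex.I)‖)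
      (𝓝[>] 0) (𝓝 0) := by
    have h2 : Tendsto (fun y : ℝ => |(F (t + y * Complex.I)).re| / δ) (𝓝[>] 0) (𝓝 0) := by
      simpa using ht.abs.div_const δ
    refine squeeze_zero_norm' ?_ h2
    filter_upwards [hev] with y hy
    rw [Real.norm_eq_abs, abs_div, abs_of_nonneg (norm_nonneg _)]
    have := hδ' y hy
    gcongr
  have h2 := (Real.continuous_arccos.tendsto 0).comp h1
  rw [Real.arccos_zero] at h2
  refine h2.congr' ?_
  filter_upwards [hev] with y hy
  have him := hFim (t + y * Complex.I) (by simpa using hy.1)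
  rw [Function.comp_apply, ← Complex.cos_arg (ne_zero_of_im_pos him),
    Real.arccos_cos (arg_pos_of_im_pos him).le (arg_lt_pi_of_im_pos him).le]

lemma lintegral_halfPlanePoisson_le_two_mul_re {f : ℂ → ℂ}
    (hf : DifferentiableOn ℂ f {z | 0 < z.im}) (hpos : ∀ z : ℂ, 0 < z.im → 0 ≤ (f z).re)
    {E : Set ℝ} (hlim : ∀ᵐ t : ℝ ∂(volume.restrict E),
      Tendsto (fun y : ℝ => (f (t + y * Complex.I)).re) (𝓝[>] 0) (𝓝 (Real.pi / 2)))
    (x : ℝ) {y : ℝ} (hy : 0 < y) :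
    ∫⁻ t in E, ENNReal.ofReal (halfPlanePoisson x y t) ≤
      ENNReal.ofReal (2 * (f (x + y * Complex.I)).re) := by
  have h := mul_lintegral_halfPlanePoisson_le hf hpos hlim x hy
  have hpi := Real.pi_pos
  rw [show Real.pi * (f (x + y * Complex.I)).re =
    Real.pi / 2 * (2 * (f (x + y * Complex.I)).re) by ring,
    ENNReal.ofReal_mul (by positivity)] at h
  exact (ENNReal.mul_le_mul_iff_right (by simpa using hpi) (by simp)).1 h

lemma lintegral_halfPlanePoisson_le_arg (hF : DifferentiableOn ℂ F {z | 0 < z.im})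
    (hFim : ∀ z : ℂ, 0 < z.im → 0 < (F z).im) {E : Set ℝ}
    (hlim : ∀ᵐ t : ℝ ∂(volume.restrict E),
      Tendsto (fun y : ℝ => (F (t + y * Complex.I)).re) (𝓝[>] 0) (𝓝 0))
    (x : ℝ) {y : ℝ} (hy : 0 < y) :
    ∫⁻ t in E, ENNReal.ofReal (halfPlanePoisson x y t) ≤
      ENNReal.ofReal (2 * (F (x + y * Complex.I)).arg) ∧
    ∫⁻ t in E, ENNReal.ofReal (halfPlanePoisson x y t) ≤
      ENNReal.ofReal (2 * (Real.pi - (F (x + y * Complex.I)).arg)) := by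
  have hlog : DifferentiableOn ℂ (fun z => Complex.log (F z)) {z | 0 < z.im} :=
    hF.clog fun z hz => mem_slitPlane_of_im_pos (hFim z hz)
  have harg := ae_tendsto_arg hF hFim hlim
  have h1 : ∀ z, (-Complex.I * Complex.log (F z)).re = (F z).arg := by
    intro z; simp [Complex.log_im]
  have h2 : ∀ z, (Real.pi + Complex.I * Complex.log (F z)).re = Real.pi - (F z).arg := by
    intro z; simp [Complex.log_im, sub_eq_add_neg]
  constructor
  · rw [← h1]
    refine lintegral_halfPlanePoisson_le_two_mul_re
      (f := fun z => -Complex.I * Complex.log (F z)) (hlog.const_mul _)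
      (fun z hz => ?_) ?_ x hy
    · rw [h1]
      exact (arg_pos_of_im_pos (hFim z hz)).le
    · simpa only [h1] using harg
  · rw [← h2]
    refine lintegral_halfPlanePoisson_le_two_mul_re
      (f := fun z => Real.pi + Complex.I * Complex.log (F z)) ((hlog.const_mul _).const_add _)
      (fun z hz => ?_) ?_ x hy
    · rw [h2]
      exact sub_nonneg.2 (arg_lt_pi_of_im_pos (hFim z hz)).le
    · simp only [h2]
      filter_upwards [harg] with t ht
      have := ht.const_sub Real.pi
      rwa [sub_half] at this

lemma abs_cauchyTransform_im_le {E : Set ℝ} (hE : MeasurableSet E) {g : ℝ → ℝ}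
    (hg : Integrable g) (hgE : ∀ t, |g t| ≤ E.indicator (fun _ => (1 / 4 : ℝ)) t) (x : ℝ) {y : ℝ}
    (hy : 0 < y) {a : ℝ} (ha : 0 ≤ a)
    (h : ∫⁻ t in E, ENNReal.ofReal (halfPlanePoisson x y t) ≤ ENNReal.ofReal (2 * a)) :
    |(cauchyTransform g (x + y * Complex.I)).im| ≤ a / 2 := by
  have hP := (integral_halfPlanePoisson_and_integrable x hy).1
  have hPE : ∫ t in E, halfPlanePoisson x y t ≤ 2 * a := by
    rw [integral_eq_lintegral_of_nonneg_ae
      (ae_of_all _ fun t => (halfPlanePoisson_pos hy x t).le)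
      (continuous_halfPlanePoisson x hy).aestronglyMeasurable]
    exact ENNReal.toReal_le_of_le_ofReal (by linarith) h
  rw [cauchyTransform_im hg x hy]
  calc |∫ t, g t * halfPlanePoisson x y t|
      ≤ ∫ t, E.indicator (fun t => 1 / 4 * halfPlanePoisson x y t) t := by
        rw [← Real.norm_eq_abs]
        refine norm_integral_le_of_norm_le ((hP.const_mul _).indicator hE)
          (ae_of_all _ fun t => ?_)
        have h0 := (halfPlanePoisson_pos hy x t).le
        rw [Real.norm_eq_abs, abs_mul, abs_of_nonneg h0]
        refine (mul_le_mul_of_nonneg_right (hgE t) h0).trans_eq ?_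
        by_cases ht : t ∈ E <;> simp [ht]
    _ = 1 / 4 * ∫ t in E, halfPlanePoisson x y t := by
        rw [integral_indicator hE, integral_const_mul]
    _ ≤ a / 2 := by linarith

/-- If `F` is reflectionless on `E` and `g` is a small function supported on `E`, then the real part
of the Cauchy transform of `g` is bounded above along almost every vertical line with respect to a
measure whose Poisson integral is dominated by `Im F`. -/
lemma ae_exists_cauchyTransform_re_le {μ : Measure ℝ} [IsLocallyFiniteMeasure μ] (hμ : μ ≠ 0)
    (hF : DifferentiableOn ℂ F {z | 0 < z.im})
    (hFim : ∀ z : ℂ, 0 < z.im → 0 < (F z).im)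
    (hFμ : ∀ x y : ℝ, 0 < y → ∫⁻ t, ENNReal.ofReal (halfPlanePoisson x y t) ∂μ ≤
      ENNReal.ofReal (F (x + y * Complex.I)).im)
    {E : Set ℝ} (hE : MeasurableSet E)
    (hlim : ∀ᵐ t : ℝ ∂(volume.restrict E),
      Tendsto (fun y : ℝ => (F (t + y * Complex.I)).re) (𝓝[>] 0) (𝓝 0))
    {g : ℝ → ℝ} (hg : Integrable g)
    (hgE : ∀ t, |g t| ≤ E.indicator (fun _ => (1 / 4 : ℝ)) t) :
    ∀ᵐ x : ℝ ∂μ, ∃ M : ℝ, ∀ y ∈ Set.Ioc (0 : ℝ) 1,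
      (cauchyTransform g (x + y * Complex.I)).re ≤ M := by
  set f : ℂ → ℂ := fun z =>
    -Complex.I * Complex.exp (Complex.log (F z) + cauchyTransform g z) with hfdef
  have hf : DifferentiableOn ℂ f {z | 0 < z.im} :=
    (((hF.clog fun z hz => mem_slitPlane_of_im_pos (hFim z hz)).add
      (differentiableOn_cauchyTransform hg)).cexp).const_mul _
  have hfre : ∀ z, (f z).re = Real.exp ((Complex.log (F z)).re + (cauchyTransform g z).re) *
      Real.sin ((F z).arg + (cauchyTransform g z).im) := by
    intro z
    simp only [hfdef]
    rw [← Complex.log_im, ← Complex.add_re, ← Complex.add_im, ← Complex.exp_im]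
    simp
  have hsin : ∀ z : ℂ, 0 < z.im → 1 / 2 * Real.sin (F z).arg ≤
      Real.sin ((F z).arg + (cauchyTransform g z).im) := by
    intro z hz
    have h0 := arg_pos_of_im_pos (hFim z hz)
    have hpi := arg_lt_pi_of_im_pos (hFim z hz)
    obtain ⟨h1, h2⟩ := lintegral_halfPlanePoisson_le_arg hF hFim hlim z.re hz
    have h3 := abs_cauchyTransform_im_le hE hg hgE z.re hz
      (by rw [Complex.re_add_im]; exact h0.le) h1
    have h4 := abs_cauchyTransform_im_le hE hg hgE z.re hz
      (by rw [Complex.re_add_im]; exact sub_nonneg.2 hpi.le) h2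
    rw [Complex.re_add_im] at h3 h4
    exact half_mul_sin_le_sin_add h0 hpi h3 h4
  have hsin0 : ∀ z : ℂ, 0 < z.im → 0 < Real.sin (F z).arg := fun z hz =>
    Real.sin_pos_of_pos_of_lt_pi (arg_pos_of_im_pos (hFim z hz)) (arg_lt_pi_of_im_pos (hFim z hz))
  have hpos : ∀ z : ℂ, 0 < z.im → 0 ≤ (f z).re := by
    intro z hz
    rw [hfre]
    have h1 := hsin z hz
    have h2 := hsin0 z hz
    exact mul_nonneg (Real.exp_pos _).le (by linarith)
  obtain ⟨ν, c, hc, hν, hrep⟩ := exists_measure_re_eq_lintegral_halfPlanePoisson hf hpos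
  filter_upwards [ae_exists_lintegral_halfPlanePoisson_le hμ hc hν] with x ⟨C, hC, hx⟩
  refine ⟨2 * C.toReal, fun y hy => ?_⟩
  have h1 := hx y hy
  rw [← hrep x y hy.1] at h1
  replace h1 := h1.trans (mul_le_mul_right (hFμ x y hy.1) C)
  have hz : 0 < ((x : ℂ) + y * Complex.I).im := by simpa using hy.1
  generalize (x : ℂ) + y * Complex.I = z at h1 hz
  rw [ENNReal.ofReal_le_iff_le_toReal (ENNReal.mul_ne_top hC (by simp)), ENNReal.toReal_mul,
    ENNReal.toReal_ofReal (hFim z hz).le, hfre, Real.exp_add] at h1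
  have h2 : (F z).im = Real.exp (Complex.log (F z)).re * Real.sin (F z).arg := by
    rw [← Complex.log_im, ← Complex.exp_im, Complex.exp_log (ne_zero_of_im_pos (hFim z hz))]
  have h3 := hsin z hz
  have h4 := hsin0 z hz
  rw [h2] at h1
  refine le_trans ((le_add_of_nonneg_right zero_le_one).trans (Real.add_one_le_exp _)) ?_
  have h5 := Real.exp_pos (Complex.log (F z)).re
  have h6 : Real.exp (cauchyTransform g z).re *
      Real.sin ((F z).arg + (cauchyTransform g z).im) ≤ C.toReal * Real.sin (F z).arg := by
    refine le_of_mul_le_mul_left ?_ h5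
    linarith
  have h7 : 0 ≤ C.toReal := ENNReal.toReal_nonneg
  refine le_of_mul_le_mul_right (a := Real.sin ((F z).arg + (cauchyTransform g z).im)) ?_
    (by linarith)
  nlinarith

end Herglotz

lemma measurableSet_truncation (x y : ℝ) : MeasurableSet {t : ℝ | y < |t - x| ∧ |t - x| ≤ 1} :=
  measurableSet_Ioc.preimage (by fun_prop : Measurable fun t : ℝ => |t - x|)

lemma abs_div_sq_add_sq_le {s y : ℝ} (hy : 0 < y) (h : |s| ≤ y ∨ 1 < |s|) :
    |s / (s ^ 2 + y ^ 2)| ≤ y / (s ^ 2 + y ^ 2) + 1 := by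
  have h0 : 0 < s ^ 2 + y ^ 2 := by positivity
  rw [abs_div, abs_of_pos h0]
  rcases h with h | h
  · have : |s| / (s ^ 2 + y ^ 2) ≤ y / (s ^ 2 + y ^ 2) := by gcongr
    linarith
  · have h1 : |s| / (s ^ 2 + y ^ 2) ≤ 1 := by
      rw [div_le_one h0, ← sq_abs s]
      nlinarith [sq_nonneg y]
    have h2 : 0 ≤ y / (s ^ 2 + y ^ 2) := by positivity
    linarith

lemma abs_inv_sub_div_sq_add_sq_le {s y : ℝ} (hy : 0 < y) (h : y < |s|) :
    |s⁻¹ - s / (s ^ 2 + y ^ 2)| ≤ y / (s ^ 2 + y ^ 2) := by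
  have h0 : 0 < s ^ 2 + y ^ 2 := by positivity
  have hs : 0 < |s| := hy.trans h
  have hs' : s ≠ 0 := abs_pos.1 hs
  have h1 : s⁻¹ - s / (s ^ 2 + y ^ 2) = y ^ 2 / (s * (s ^ 2 + y ^ 2)) := by
    field_simp
    ring
  rw [h1, abs_div, abs_mul, abs_of_pos h0, abs_of_pos (pow_pos hy 2),
    div_le_div_iff₀ (by positivity) h0]
  have := mul_le_mul_of_nonneg_left h.le hy.le
  nlinarith

/-- The truncated Hilbert transform and the real part of the Cauchy transform differ by a bounded
amount. -/
lemma abs_truncation_sub_cauchyTransform_re_le {g : ℝ → ℝ} (hg : Integrable g)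
    (hg1 : ∀ t, |g t| ≤ 1) (x : ℝ) {y : ℝ} (hy : 0 < y) :
    |(∫ t in {t : ℝ | y < |t - x| ∧ |t - x| ≤ 1}, g t / (t - x)) -
      (cauchyTransform g (x + y * Complex.I)).re| ≤ Real.pi + ∫ t, |g t| := by
  have hS := measurableSet_truncation x y
  obtain ⟨hP, hPint⟩ := integral_halfPlanePoisson_and_integrable x hy
  have h1 : Integrable ({t : ℝ | y < |t - x| ∧ |t - x| ≤ 1}.indicator fun t => g t / (t - x)) := by
    refine (hg.abs.mul_const y⁻¹).mono' ((AEMeasurable.aestronglyMeasurable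
      (hg.aemeasurable.div (by fun_prop))).indicator hS) (ae_of_all _ fun t => ?_)
    by_cases ht : t ∈ {t : ℝ | y < |t - x| ∧ |t - x| ≤ 1}
    · rw [Set.indicator_of_mem ht, Real.norm_eq_abs, abs_div, div_eq_mul_inv]
      exact mul_le_mul_of_nonneg_left (inv_anti₀ hy ht.1.le) (abs_nonneg _)
    · rw [Set.indicator_of_notMem ht, norm_zero]
      positivity
  have h2 : Integrable fun t => g t * ((t - x) / ((t - x) ^ 2 + y ^ 2)) := by
    have := Complex.reCLM.integrable_comp
      (integrable_mul_inv_ofReal_sub hg (z := x + y * Complex.I) (by simpa using hy))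
    simpa only [Complex.reCLM_apply, Complex.re_ofReal_mul, inv_ofReal_sub_re] using this
  rw [cauchyTransform_re hg x hy, ← integral_indicator hS, ← integral_sub h1 h2, ← hPint,
    ← integral_add hP hg.abs, ← Real.norm_eq_abs]
  refine norm_integral_le_of_norm_le (hP.add hg.abs) (ae_of_all _ fun t => ?_)
  have hP0 := (halfPlanePoisson_pos hy x t).le
  have hgP : |g t| * halfPlanePoisson x y t ≤ halfPlanePoisson x y t :=
    mul_le_of_le_one_left hP0 (hg1 t)
  have hg0 := abs_nonneg (g t)
  rw [Real.norm_eq_abs]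
  by_cases ht : t ∈ {t : ℝ | y < |t - x| ∧ |t - x| ≤ 1}
  · rw [Set.indicator_of_mem ht, div_eq_mul_inv (g t), ← mul_sub, abs_mul]
    have := mul_le_mul_of_nonneg_left (abs_inv_sub_div_sq_add_sq_le hy ht.1) hg0
    change _ ≤ |g t| * halfPlanePoisson x y t at this
    linarith
  · rw [Set.indicator_of_notMem ht, zero_sub, abs_neg, abs_mul]
    have ht' : |t - x| ≤ y ∨ 1 < |t - x| := by
      by_contra! h
      exact ht h
    have := mul_le_mul_of_nonneg_left (abs_div_sq_add_sq_le hy ht') hg0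
    change _ ≤ |g t| * (halfPlanePoisson x y t + 1) at this
    linarith

lemma cauchyTransform_neg (g : ℝ → ℝ) (z : ℂ) :
    cauchyTransform (fun t => -g t) z = -cauchyTransform g z := by
  simp only [cauchyTransform, Complex.ofReal_neg, neg_mul, integral_neg]

/-- Theorem 1.1(c): if `μ ∈ R(E)` and `θ ∈ L^∞(E)`, then the singular part of `μ` is
supported by the set of points `x` where
`sup_{0<y≤1} |∫_{y<|t-x|≤1} θ(t) χ_E(t)/(t-x) dt| < ∞`. -/
theorem singularPart_supported_on_bounded_truncated_hilbert
    (E : Set ℝ) (hE : MeasurableSet E) (μ : Measure ℝ) (hμ : IsReflectionless μ E)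
    (θ : ℝ → ℝ) (hθmeas : Measurable θ) (hθbdd : ∃ M : ℝ, ∀ t ∈ E, |θ t| ≤ M) :
    μ.singularPart volume
      {x : ℝ | ¬ ∃ M : ℝ, ∀ y ∈ Set.Ioc (0 : ℝ) 1,
        |∫ t in {t : ℝ | y < |t - x| ∧ |t - x| ≤ 1}, E.indicator θ t / (t - x)| ≤ M} = 0 := by
  refine le_antisymm ((Measure.singularPart_le μ volume _).trans_eq ?_) zero_le
  rw [← ae_iff]
  rcases eq_or_ne μ 0 with rfl | hμ0
  · simp
  obtain ⟨hint, a, b, hb, hlim⟩ := hμ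
  have : IsLocallyFiniteMeasure μ := isLocallyFiniteMeasure_of_lintegral_inv_sq_add_one
    hint.lintegral_lt_top.ne
  obtain ⟨M₀, hM₀⟩ := hθbdd
  set M : ℝ := max M₀ 1 with hM
  have hM0 : 0 < M := one_pos.trans_le (le_max_right _ _)
  have hθM : ∀ t ∈ E, |θ t| ≤ M := fun t ht => (hM₀ t ht).trans (le_max_left _ _)
  have key : ∀ N : ℕ, ∀ᵐ x : ℝ ∂μ, |x| ≤ N → ∃ M : ℝ, ∀ y ∈ Set.Ioc (0 : ℝ) 1,
      |∫ t in {t : ℝ | y < |t - x| ∧ |t - x| ≤ 1}, E.indicator θ t / (t - x)| ≤ M := by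
    intro N
    set J : Set ℝ := E ∩ Set.Icc (-(N + 1 : ℝ)) (N + 1) with hJ
    have hJm : MeasurableSet J := hE.inter measurableSet_Icc
    have hJfin : volume J ≠ ⊤ :=
      ((measure_mono Set.inter_subset_right).trans_lt measure_Icc_lt_top).ne
    set g : ℝ → ℝ := fun t => (4 * M)⁻¹ * J.indicator θ t with hgdef
    have hgE : ∀ t, |g t| ≤ E.indicator (fun _ => (1 / 4 : ℝ)) t := by
      intro t
      by_cases htE : t ∈ E
      · rw [Set.indicator_of_mem htE, hgdef, abs_mul, abs_of_pos (by positivity),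
          inv_mul_le_iff₀ (by positivity)]
        by_cases ht : t ∈ J
        · rw [Set.indicator_of_mem ht]
          linarith [hθM t htE]
        · rw [Set.indicator_of_notMem ht, abs_zero]
          positivity
      · have ht : t ∉ J := fun h => htE h.1
        simp [hgdef, htE, ht]
    have hg : Integrable g := by
      refine Integrable.const_mul ?_ _
      rw [integrable_indicator_iff hJm]
      refine Measure.integrableOn_of_bounded (M := M) hJfin hθmeas.aestronglyMeasurable ?_
      filter_upwards [ae_restrict_mem hJm] with t ht
      exact hθM t ht.1
    have hg1 : ∀ t, |g t| ≤ 1 := fun t => (hgE t).trans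
      (Set.indicator_le' (fun _ _ => by norm_num) (fun _ _ => zero_le_one) t)
    have hF := differentiableOn_herglotzFn hint a b
    have hFim : ∀ z : ℂ, 0 < z.im → 0 < (herglotzFn μ a b z).im :=
      fun z hz => herglotzFn_im_pos hμ0 hint a hb hz
    have hFμ := fun (x y : ℝ) (hy : 0 < y) =>
      lintegral_halfPlanePoisson_le_herglotzFn_im hint a hb x hy
    filter_upwards [ae_exists_cauchyTransform_re_le hμ0 hF hFim hFμ hE hlim hg hgE,
      ae_exists_cauchyTransform_re_le hμ0 hF hFim hFμ hE hlim hg.neg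
        (by simpa only [Pi.neg_apply, abs_neg] using hgE)] with x ⟨M₁, h1⟩ ⟨M₂, h2⟩ hx
    refine ⟨4 * M * (Real.pi + (∫ t, |g t|) + max M₁ M₂), fun y hy => ?_⟩
    have heq : ∫ t in {t : ℝ | y < |t - x| ∧ |t - x| ≤ 1}, E.indicator θ t / (t - x) =
        4 * M * ∫ t in {t : ℝ | y < |t - x| ∧ |t - x| ≤ 1}, g t / (t - x) := by
      rw [← integral_const_mul]
      refine setIntegral_congr_fun (measurableSet_truncation x y) fun t ht => ?_
      have htI : t ∈ Set.Icc (-(N + 1 : ℝ)) (N + 1) := by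
        have h3 := abs_le.1 ht.2
        have h4 := abs_le.1 hx
        exact ⟨by linarith, by linarith⟩
      have hθJ : E.indicator θ t = J.indicator θ t := by
        by_cases htE : t ∈ E
        · rw [Set.indicator_of_mem htE, Set.indicator_of_mem (show t ∈ J from ⟨htE, htI⟩)]
        · rw [Set.indicator_of_notMem htE,
            Set.indicator_of_notMem (show t ∉ J from fun h => htE h.1)]
      simp only [hθJ, hgdef]
      rw [← mul_div_assoc, mul_inv_cancel_left₀ (by positivity)]
    have h2' := h2 y hy
    change (cauchyTransform (fun t => -g t) _).re ≤ M₂ at h2'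
    rw [cauchyTransform_neg, Complex.neg_re] at h2'
    have hre : |(cauchyTransform g (x + y * Complex.I)).re| ≤ max M₁ M₂ :=
      abs_le'.2 ⟨(h1 y hy).trans (le_max_left _ _), h2'.trans (le_max_right _ _)⟩
    have hdiff := abs_truncation_sub_cauchyTransform_re_le hg hg1 x hy.1
    rw [heq, abs_mul, abs_of_pos (by positivity)]
    refine mul_le_mul_of_nonneg_left ?_ (by positivity)
    have := (abs_sub_abs_le_abs_sub _ _).trans hdiff
    linarith
  filter_upwards [ae_all_iff.2 key] with x hx
  obtain ⟨N, hN⟩ := exists_nat_ge |x|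
  exact hx N hN
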